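/- Let Λ = A_{n,m} with m ≥ n and m = k₀n + s₁ with k₀ ≥ 3 and 0 < s₁ < n. Then rigdim(A_{n,m}) = 2, i.e., for every generator-cogenerator M with gldim End_Λ(M) < ∞ one has Ext¹_Λ(M,M) ≠ 0. -/

import Mathlib

open CategoryTheory CategoryTheory.Limits Opposite

universe u

namespace Rigidity

variable (Λ : Type u) [Ring Λ]

/-- `X` belongs to `add M`: it is a direct summand of a finite direct sum of copies of `M`. -/
def InAdd (M X : ModuleCat.{u} Λ) : Prop :=
  ∃ (r : ℕ) (Y : ModuleCat.{u} Λ), Nonempty ((X ⊞ Y) ≅ ⨁ (fun _ : Fin r => M))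

/-- An indecomposable object. -/
def Indec (X : ModuleCat.{u} Λ) : Prop :=
  ¬ IsZero X ∧ ∀ A B : ModuleCat.{u} Λ, Nonempty (X ≅ A ⊞ B) → IsZero A ∨ IsZero B

/-- A generator-cogenerator: `add M` contains the regular module and all
finitely generated injective modules. -/
def IsGenCogen (M : ModuleCat.{u} Λ) : Prop :=
  InAdd Λ M (ModuleCat.of Λ Λ) ∧
  ∀ I : ModuleCat.{u} Λ, Module.Finite Λ I → Injective I → InAdd Λ M I

/-- `g : A ⟶ X` is a right minimal `add M`-approximation. -/
def IsRMApprox (M : ModuleCat.{u} Λ) {A X : ModuleCat.{u} Λ} (g : A ⟶ X) : Prop :=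
  InAdd Λ M A ∧
  (∀ T : ModuleCat.{u} Λ, InAdd Λ M T → ∀ f : T ⟶ X, ∃ h : T ⟶ A, h ≫ g = f) ∧
  (∀ h : A ⟶ A, h ≫ g = g → IsIso h)

/-- `IsMSyzygy M X r W` : `W` is an `r`-th `M`-syzygy `Ω_M^r(X)` of `X`. -/
inductive IsMSyzygy (M : ModuleCat.{u} Λ) : ModuleCat.{u} Λ → ℕ → ModuleCat.{u} Λ → Prop
  | zero (X : ModuleCat.{u} Λ) : IsMSyzygy M X 0 X
  | succ (X : ModuleCat.{u} Λ) (r : ℕ) (W A : ModuleCat.{u} Λ) (g : A ⟶ W)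
      (hW : IsMSyzygy M X r W) (hg : IsRMApprox Λ M g) :
      IsMSyzygy M X (r + 1) (kernel g)

/-- The `M`-dimension of `X` is at most `r`. -/
def MdimLE (M X : ModuleCat.{u} Λ) (r : ℕ) : Prop :=
  ∃ W : ModuleCat.{u} Λ, IsMSyzygy Λ M X r W ∧ InAdd Λ M W

/-- projective dimension at most `r`, via a length `r` projective resolution. -/
def ProjDimLE (A : Type u) [Ring A] (N : ModuleCat.{u} A) (r : ℕ) : Prop :=
  ∃ (P : ℕ → ModuleCat.{u} A) (d : ∀ i : ℕ, P (i + 1) ⟶ P i) (f : P 0 ⟶ N),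
    (∀ i, Projective (P i)) ∧ (∀ i, r < i → IsZero (P i)) ∧ Epi f ∧
    (∃ w : d 0 ≫ f = 0, (ShortComplex.mk (d 0) f w).Exact) ∧
    (∀ i, ∃ w : d (i + 1) ≫ d i = 0, (ShortComplex.mk (d (i + 1)) (d i) w).Exact)

/-- global dimension at most `r`. -/
def GldimLE (A : Type u) [Ring A] (r : ℕ) : Prop :=
  ∀ N : ModuleCat.{u} A, ProjDimLE A N r

/-- the global dimension, as an element of `ℕ∞`. -/
noncomputable def gldim (A : Type u) [Ring A] : ℕ∞ :=
  sInf {c : ℕ∞ | ∃ r : ℕ, c = (r : ℕ∞) ∧ GldimLE A r}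

/-- dominant dimension at least `r`: there is an exact sequence
`0 → A → I^0 → ⋯ → I^(r-1)` with all `I^i` projective-injective. -/
def DomdimGE (A : Type u) [Ring A] (r : ℕ) : Prop :=
  ∃ (I : ℕ → ModuleCat.{u} A) (f : ModuleCat.of A A ⟶ I 0) (g : ∀ i : ℕ, I i ⟶ I (i + 1)),
    Mono f ∧ (∀ i, i < r → Injective (I i) ∧ Projective (I i)) ∧
    (2 ≤ r → ∃ w : f ≫ g 0 = 0, (ShortComplex.mk f (g 0) w).Exact) ∧
    (∀ i, i + 3 ≤ r → ∃ w : g i ≫ g (i + 1) = 0, (ShortComplex.mk (g i) (g (i + 1)) w).Exact)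

/-- the dominant dimension, as an element of `ℕ∞`. -/
noncomputable def domdim (A : Type u) [Ring A] : ℕ∞ :=
  sSup {c : ℕ∞ | ∃ r : ℕ, c = (r : ℕ∞) ∧ DomdimGE A r}

/-- the rigidity degree of a module, as an element of `ℕ∞`. -/
noncomputable def rigDeg [HasExt.{u} (ModuleCat.{u} Λ)] (M : ModuleCat.{u} Λ) : ℕ∞ :=
  sSup {c : ℕ∞ | ∃ r : ℕ, c = (r : ℕ∞) ∧ 0 < r ∧
    ∀ i : ℕ, 1 ≤ i → i ≤ r → Subsingleton (Abelian.Ext M M i)}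

/-- the rigidity dimension. -/
noncomputable def rigdim : ℕ∞ :=
  sSup {c : ℕ∞ | ∃ M : ModuleCat.{u} Λ, Module.Finite Λ M ∧ IsGenCogen Λ M ∧
    (∃ r : ℕ, GldimLE (End (op M)) r) ∧ c = domdim (End (op M))}

/-- An Auslander-Reiten (almost split) sequence. -/
def IsARSeq {X Y Z : ModuleCat.{u} Λ} (f : X ⟶ Y) (g : Y ⟶ Z) : Prop :=
  Mono f ∧ Epi g ∧ (∃ w : f ≫ g = 0, (ShortComplex.mk f g w).Exact) ∧
  Indec Λ X ∧ Indec Λ Z ∧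
  (¬ ∃ s : Z ⟶ Y, s ≫ g = 𝟙 Z) ∧
  (∀ (W : ModuleCat.{u} Λ) (h : W ⟶ Z), (¬ ∃ s : Z ⟶ W, s ≫ h = 𝟙 Z) →
    ∃ h' : W ⟶ Y, h' ≫ g = h)

/-- `X` has composition length `t`. -/
def HasCompLength (X : ModuleCat.{u} Λ) (t : ℕ) : Prop :=
  (∃ c : Fin (t + 1) → Submodule Λ X, StrictMono c ∧ c 0 = ⊥ ∧ c (Fin.last t) = ⊤) ∧
  ∀ r : ℕ, (∃ c : Fin (r + 1) → Submodule Λ X, StrictMono c ∧ c 0 = ⊥ ∧ c (Fin.last r) = ⊤) →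
    r ≤ t


/-- powers of the Jacobson radical, as left submodules of `Λ`. -/
def radPow (Λ : Type u) [Ring Λ] : ℕ → Submodule Λ Λ
  | 0 => ⊤
  | r + 1 => Submodule.span Λ
      {x : Λ | ∃ a ∈ Ideal.jacobson (⊥ : Ideal Λ), ∃ b ∈ radPow Λ r, x = a * b}

/-- `Λ` is the connected self-injective Nakayama algebra over `k`
with `n` simple modules and Loewy length `m`. -/
structure IsSelfInjNakayama (k : Type u) (Λ : Type u) [Field k] [Ring Λ] [Algebra k Λ]
    (n m : ℕ) : Prop where
  findim : FiniteDimensional k Λ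
  connected : ∀ e : Λ, IsIdempotentElem e → e ∈ Set.center Λ → e = 0 ∨ e = 1
  selfinj : Injective (ModuleCat.of Λ Λ)
  uniserial : ∀ X : ModuleCat.{u} Λ, Module.Finite Λ X → Indec Λ X →
    ∀ N₁ N₂ : Submodule Λ X, N₁ ≤ N₂ ∨ N₂ ≤ N₁
  simples : ∃ S : Fin n → ModuleCat.{u} Λ, (∀ i, IsSimpleModule Λ (S i)) ∧
    (∀ i j, Nonempty (S i ≅ S j) → i = j) ∧
    ∀ T : ModuleCat.{u} Λ, IsSimpleModule Λ T → ∃ i, Nonempty (T ≅ S i)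
  loewy_top : radPow Λ m = ⊥
  loewy_bot : radPow Λ (m - 1) ≠ ⊥


section EndFunctor

variable {Λ}

lemma inAdd_iff {M X : ModuleCat.{u} Λ} :
    InAdd Λ M X ↔ ∃ r : ℕ, Nonempty (Retract X (⨁ (fun _ : Fin r => M))) := by
  constructor
  · rintro ⟨r, Y, ⟨e⟩⟩
    exact ⟨r, ⟨⟨biprod.inl ≫ e.hom, e.inv ≫ biprod.fst, by simp⟩⟩⟩
  · rintro ⟨r, ⟨h⟩⟩
    have : IsSplitMono h.i := ⟨⟨⟨h.r, h.retract⟩⟩⟩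
    let B := binaryBiconeOfIsSplitMonoOfCokernel (cokernelIsCokernel h.i)
    have hB : B.IsBilimit := isBilimitBinaryBiconeOfIsSplitMonoOfCokernel (cokernelIsCokernel h.i)
    exact ⟨r, cokernel h.i, ⟨(biprod.uniqueUpToIso _ _ hB).symm⟩⟩

lemma InAdd.of_retract {M X Y : ModuleCat.{u} Λ} (h : InAdd Λ M Y) (e : Retract X Y) :
    InAdd Λ M X := by
  obtain ⟨r, ⟨f⟩⟩ := inAdd_iff.1 h
  exact inAdd_iff.2 ⟨r, ⟨e.trans f⟩⟩

lemma InAdd.of_iso {M X Y : ModuleCat.{u} Λ} (h : InAdd Λ M Y) (e : X ≅ Y) :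
    InAdd Λ M X := h.of_retract ⟨e.hom, e.inv, by simp⟩

lemma inAdd_of_finite {M : ModuleCat.{u} Λ} {ι : Type} [Finite ι] {X : ModuleCat.{u} Λ}
    (i : ι → (X ⟶ M)) (p : ι → (M ⟶ X)) [Fintype ι] (h : ∑ j, i j ≫ p j = 𝟙 X) :
    InAdd Λ M X := by
  refine inAdd_iff.2 ⟨Fintype.card ι, ⟨⟨biproduct.lift fun a => i ((Fintype.equivFin ι).symm a),
    biproduct.desc fun a => p ((Fintype.equivFin ι).symm a), ?_⟩⟩⟩
  rw [biproduct.lift_desc, ← h]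
  exact Fintype.sum_equiv (Fintype.equivFin ι).symm _ _ (fun _ => rfl)

lemma InAdd.exists_sum {M X : ModuleCat.{u} Λ} (h : InAdd Λ M X) :
    ∃ (r : ℕ) (i : Fin r → (X ⟶ M)) (p : Fin r → (M ⟶ X)), ∑ j, i j ≫ p j = 𝟙 X := by
  obtain ⟨r, ⟨f⟩⟩ := inAdd_iff.1 h
  refine ⟨r, fun j => f.i ≫ biproduct.π _ j, fun j => biproduct.ι (fun _ : Fin r => M) j ≫ f.r, ?_⟩
  have := congrArg (fun g => f.i ≫ g ≫ f.r) (biproduct.total (f := fun _ : Fin r => M))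
  simp only [Category.id_comp, f.retract] at this
  rw [← this, Preadditive.sum_comp, Preadditive.comp_sum]
  simp only [Category.assoc]

lemma InAdd.biprod {M X Y : ModuleCat.{u} Λ} (hX : InAdd Λ M X) (hY : InAdd Λ M Y) :
    InAdd Λ M (X ⊞ Y) := by
  obtain ⟨r, i, p, h⟩ := hX.exists_sum
  obtain ⟨r', i', p', h'⟩ := hY.exists_sum
  refine inAdd_of_finite (ι := Fin r ⊕ Fin r')
    (Sum.elim (fun j => biprod.fst ≫ i j) (fun j => biprod.snd ≫ i' j))
    (Sum.elim (fun j => p j ≫ biprod.inl) (fun j => p' j ≫ biprod.inr)) ?_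
  simp only [Fintype.sum_sum_type, Sum.elim_inl, Sum.elim_inr, Category.assoc]
  have e1 : ∀ j, biprod.fst ≫ i j ≫ p j ≫ (biprod.inl : X ⟶ X ⊞ Y) =
      (biprod.fst : X ⊞ Y ⟶ X) ≫ (i j ≫ p j) ≫ biprod.inl := by simp
  have e2 : ∀ j, biprod.snd ≫ i' j ≫ p' j ≫ (biprod.inr : Y ⟶ X ⊞ Y) =
      (biprod.snd : X ⊞ Y ⟶ Y) ≫ (i' j ≫ p' j) ≫ biprod.inr := by simp
  simp only [e1, e2]
  rw [← Preadditive.comp_sum, ← Preadditive.comp_sum, ← Preadditive.sum_comp,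
    ← Preadditive.sum_comp, h, h']
  simp

lemma inAdd_self (M : ModuleCat.{u} Λ) : InAdd Λ M M :=
  inAdd_of_finite (ι := Unit) (fun _ => 𝟙 M) (fun _ => 𝟙 M) (by simp)

lemma inAdd_of_isZero {M X : ModuleCat.{u} Λ} (h : IsZero X) : InAdd Λ M X :=
  (inAdd_self M).of_retract ⟨0, 0, h.eq_of_src _ _⟩

/-- The endomorphism ring computed in the opposite category. -/
def endOpRingEquiv (M : ModuleCat.{u} Λ) : End (op M) ≃+* (End M)ᵐᵒᵖ where
  toFun x := MulOpposite.op x.unop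
  invFun x := (MulOpposite.unop x).op
  left_inv _ := rfl
  right_inv _ := rfl
  map_mul' _ _ := rfl
  map_add' _ _ := rfl

variable {A : Type u} [Ring A] {M : ModuleCat.{u} Λ} (e : A ≃+* (End M)ᵐᵒᵖ)

/-- The functor `Hom(M, -)` to modules over a ring identified with `(End M)ᵐᵒᵖ`. -/
noncomputable def homFunctor : ModuleCat.{u} Λ ⥤ ModuleCat.{u} A :=
  preadditiveCoyonedaObj M ⋙ ModuleCat.restrictScalars e.toRingHom

instance : (homFunctor e).Additive := by
  unfold homFunctor; infer_instance

instance : PreservesLimits (homFunctor e) := by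
  unfold homFunctor
  have h1 : PreservesLimits (preadditiveCoyonedaObj M) := inferInstance
  infer_instance

/-- A morphism `M ⟶ X` as an element of `Hom(M, X)`. -/
def elemOfHom {X : ModuleCat.{u} Λ} (x : M ⟶ X) : (homFunctor e).obj X := x

/-- `Hom(M, M)` is the regular module. -/
noncomputable def homFunctorSelfEquiv : (homFunctor e).obj M ≃ₗ[A] A where
  toFun x := e.symm (MulOpposite.op (show M ⟶ M from x))
  invFun x := elemOfHom e (e x).unop
  left_inv x := by simp only [elemOfHom, RingEquiv.apply_symm_apply]; rfl
  right_inv x := by simp [elemOfHom]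
  map_add' x y := map_add e.symm (MulOpposite.op (show End M from x))
    (MulOpposite.op (show End M from y))
  map_smul' a x := by
    change e.symm (e a * MulOpposite.op (show End M from x)) = _
    simp

/-- `Hom(M, M)` is the regular module. -/
noncomputable def homFunctorSelfIso : (homFunctor e).obj M ≅ ModuleCat.of A A :=
  (homFunctorSelfEquiv e).toModuleIso

lemma projective_homFunctor_obj {X : ModuleCat.{u} Λ} (h : InAdd Λ M X) :
    Projective ((homFunctor e).obj X) := by
  obtain ⟨r, i, p, h⟩ := h.exists_sum
  have h1 : Projective ((homFunctor e).obj M) :=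
    Projective.of_iso (homFunctorSelfIso e).symm
      ((ModuleCat.of A A).projective_of_free (Module.Basis.singleton Unit _))
  refine ⟨fun {W Z} f q hq => ⟨∑ j, (homFunctor e).map (i j) ≫
    Projective.factorThru ((homFunctor e).map (p j) ≫ f) q, ?_⟩⟩
  have := congrArg (fun g => (homFunctor e).map g ≫ f) h
  simpa [Functor.map_sum, Preadditive.sum_comp] using this

end EndFunctor

lemma hasProjectiveDimensionLT_X₁_of_factors {C : Type*} [Category* C] [Abelian C]
    {S : ShortComplex C} (hS : S.ShortExact) {P : C} [Projective P] (a : S.X₁ ⟶ P) (b : P ⟶ S.X₂)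
    (hab : a ≫ b = S.f) (r : ℕ) (h : HasProjectiveDimensionLT S.X₃ (r + 2)) :
    HasProjectiveDimensionLT S.X₁ (r + 1) := by
  let := HasExt.standard C
  rw [hasProjectiveDimensionLT_iff]
  rintro (_ | i) hi Y x₁
  · omega
  · obtain ⟨x₂, rfl⟩ := Abelian.Ext.contravariant_sequence_exact₁ hS _ x₁ (add_comm _ _)
      (Abelian.Ext.eq_zero_of_hasProjectiveDimensionLT _ (r + 2) (by lia))
    rw [← hab, ← Abelian.Ext.mk₀_comp_mk₀, Abelian.Ext.comp_assoc_of_second_deg_zero,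
      Abelian.Ext.eq_zero_of_projective ((Abelian.Ext.mk₀ b).comp x₂ _), Abelian.Ext.comp_zero]

section EndFunctor

variable {Λ}
variable {A : Type u} [Ring A] {M : ModuleCat.{u} Λ} (e : A ≃+* (End M)ᵐᵒᵖ)

lemma isSeparator_of_inAdd (h : InAdd Λ M (ModuleCat.of Λ Λ)) : IsSeparator M := by
  obtain ⟨r, i, p, h⟩ := h.exists_sum
  rw [isSeparator_def]
  intro X Y f g hfg
  ext x
  let ξ : ModuleCat.of Λ Λ ⟶ X := ModuleCat.ofHom (LinearMap.toSpanSingleton Λ X x)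
  have h1 : ξ ≫ f = ξ ≫ g := by
    rw [← Category.id_comp ξ, ← h]
    simp only [Preadditive.sum_comp, Category.assoc]
    refine Finset.sum_congr rfl fun j _ => ?_
    have := hfg (p j ≫ ξ)
    simp only [Category.assoc] at this
    rw [this]
  have h2 := ConcreteCategory.congr_hom h1 (1 : Λ)
  simpa [ξ] using h2

lemma homFunctor_faithful (h : InAdd Λ M (ModuleCat.of Λ Λ)) : (homFunctor e).Faithful := by
  have := (isSeparator_iff_faithful_preadditiveCoyonedaObj M).1 (isSeparator_of_inAdd h)
  unfold homFunctor; infer_instance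

lemma homFunctor_full (h : InAdd Λ M (ModuleCat.of Λ Λ)) : (homFunctor e).Full := by
  have := IsGrothendieckAbelian.GabrielPopescu.full M (isSeparator_of_inAdd h)
  unfold homFunctor
  infer_instance

lemma homFunctor_preservesInjectiveObjects (h : InAdd Λ M (ModuleCat.of Λ Λ)) :
    (homFunctor e).PreservesInjectiveObjects := by
  have := IsGrothendieckAbelian.GabrielPopescu.preservesInjectiveObjects M (isSeparator_of_inAdd h)
  unfold homFunctor
  infer_instance

lemma homFunctor_mono {X Y : ModuleCat.{u} Λ} (f : X ⟶ Y) [Mono f] :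
    Mono ((homFunctor e).map f) := inferInstance

lemma homFunctor_map_exact {S : ShortComplex (ModuleCat.{u} Λ)} (hS : S.Exact) [Mono S.f] :
    (S.map (homFunctor e)).Exact := by
  rw [ShortComplex.moduleCat_exact_iff]
  intro (x : M ⟶ S.X₂) (hx : x ≫ S.g = 0)
  exact ⟨elemOfHom e (hS.lift x hx), hS.lift_f x hx⟩

lemma homFunctor_map_shortExact {S : ShortComplex (ModuleCat.{u} Λ)} (hS : S.ShortExact)
    (hlift : ∀ f : M ⟶ S.X₃, ∃ g : M ⟶ S.X₂, g ≫ S.g = f) :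
    (S.map (homFunctor e)).ShortExact := by
  have := hS.mono_f
  refine { exact := homFunctor_map_exact e hS.exact, mono_f := homFunctor_mono e S.f, epi_g := ?_ }
  rw [ModuleCat.epi_iff_surjective]
  intro (x : M ⟶ S.X₃)
  obtain ⟨g, hg⟩ := hlift x
  exact ⟨elemOfHom e g, hg⟩

lemma homFunctor_syzygy {S : ShortComplex (ModuleCat.{u} Λ)} (hS : S.ShortExact)
    (hlift : ∀ f : M ⟶ S.X₃, ∃ g : M ⟶ S.X₂, g ≫ S.g = f)
    {P : ModuleCat.{u} Λ} (hP : InAdd Λ M P) (a : S.X₁ ⟶ P) (b : P ⟶ S.X₂)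
    (hab : a ≫ b = S.f) (r : ℕ)
    (h : HasProjectiveDimensionLT ((homFunctor e).obj S.X₃) (r + 2)) :
    HasProjectiveDimensionLT ((homFunctor e).obj S.X₁) (r + 1) := by
  have := projective_homFunctor_obj e hP
  exact hasProjectiveDimensionLT_X₁_of_factors (homFunctor_map_shortExact e hS hlift)
    ((homFunctor e).map a) ((homFunctor e).map b)
    (((homFunctor e).map_comp a b).symm.trans (congrArg _ hab)) r h

lemma homFunctor_split (hM : InAdd Λ M (ModuleCat.of Λ Λ))
    {S : ShortComplex (ModuleCat.{u} Λ)} (hS : S.ShortExact)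
    (hlift : ∀ f : M ⟶ S.X₃, ∃ g : M ⟶ S.X₂, g ≫ S.g = f)
    (h : Projective ((homFunctor e).obj S.X₃)) : ∃ s : S.X₃ ⟶ S.X₂, s ≫ S.g = 𝟙 _ := by
  have := homFunctor_faithful e hM
  have := homFunctor_full e hM
  have h1 := homFunctor_map_shortExact e hS hlift
  have : Epi ((homFunctor e).map S.g) := h1.epi_g
  obtain ⟨s, hs⟩ := (homFunctor e).map_surjective
    (Projective.factorThru (𝟙 ((homFunctor e).obj S.X₃)) ((homFunctor e).map S.g))
  refine ⟨s, (homFunctor e).map_injective ?_⟩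
  rw [Functor.map_comp, hs, Projective.factorThru_comp, CategoryTheory.Functor.map_id]

/-- A retract of `Hom(M, Y)` with `Y` injective is `Hom(M, -)` of an injective. -/
lemma exists_injective_of_retract (hM : InAdd Λ M (ModuleCat.of Λ Λ)) {I : ModuleCat.{u} A}
    {Y : ModuleCat.{u} Λ} [Injective Y] (ρ : Retract I ((homFunctor e).obj Y)) :
    ∃ E : ModuleCat.{u} Λ, Injective E ∧ Nonempty (I ≅ (homFunctor e).obj E) := by
  have := homFunctor_faithful e hM
  have := homFunctor_full e hM
  obtain ⟨p, hp⟩ := (homFunctor e).map_surjective (ρ.r ≫ ρ.i)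
  have hidem : p ≫ p = p := (homFunctor e).map_injective (by
    rw [Functor.map_comp, hp]; simp)
  obtain ⟨E, i, q, h1, h2⟩ := IsIdempotentComplete.idempotents_split Y p hidem
  refine ⟨E, (⟨i, q, h1⟩ : Retract E Y).injective, ⟨⟨ρ.i ≫ (homFunctor e).map q,
    (homFunctor e).map i ≫ ρ.r, ?_, ?_⟩⟩⟩
  · rw [Category.assoc, ← Category.assoc _ _ ρ.r, ← Functor.map_comp, h2, hp]
    simp
  · rw [Category.assoc, ← Category.assoc ρ.r, ← hp, ← Functor.map_comp, ← Functor.map_comp,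
      ← CategoryTheory.Functor.map_id, ← h2]
    congr 1
    simp [h1]

end EndFunctor

section ProjectiveDimension

variable {A : Type u} [Ring A]

lemma hasProjectiveDimensionLT_of_projDimLE (r : ℕ) (N : ModuleCat.{u} A) (h : ProjDimLE A N r) :
    HasProjectiveDimensionLT N (r + 1) := by
  induction r generalizing N with
  | zero =>
    obtain ⟨P, d, f, hP, hz, hf, ⟨w, hex⟩, -⟩ := h
    have : d 0 = 0 := (hz 1 (by lia)).eq_of_src _ _
    have : Mono f := (ShortComplex.exact_iff_mono _ this).1 hex
    have : IsIso f := isIso_of_mono_of_epi f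
    have : Projective N := Projective.of_iso (asIso f) (hP 0)
    infer_instance
  | succ r ih =>
    obtain ⟨P, d, f, hP, hz, hf, ⟨w, hex⟩, hex'⟩ := h
    have hS : (ShortComplex.mk _ _ (kernel.condition f)).ShortExact :=
      { exact := ShortComplex.exact_kernel f }
    have hK : ProjDimLE A (kernel f) r := by
      refine ⟨fun i => P (i + 1), fun i => d (i + 1), kernel.lift f (d 0) w, fun i => hP _,
        fun i hi => hz _ (by lia), hex.epi_kernelLift, ?_, fun i => hex' _⟩
      obtain ⟨w', hw'⟩ := hex' 0
      refine ⟨by rw [← cancel_mono (kernel.ι f)]; simp [w'], ?_⟩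
      rw [ShortComplex.moduleCat_exact_iff] at hw' ⊢
      intro x hx
      refine hw' x ?_
      have h1 := congrArg (kernel.ι f).hom hx
      have h2 : d 0 = kernel.lift f (d 0) w ≫ kernel.ι f := by simp
      change (d 0).hom x = 0
      refine (ConcreteCategory.congr_hom h2 x).trans ?_
      simpa using h1
    have hK' := ih _ hK
    have := hP 0
    exact hS.hasProjectiveDimensionLT_X₃ _ hK' (inferInstanceAs (HasProjectiveDimensionLT (P 0) _))

open ZeroObject in
lemma projDimLE_zero (N : ModuleCat.{u} A) [Projective N] : ProjDimLE A N 0 := by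
  refine ⟨fun i => Nat.casesOn i N (fun _ => 0), fun i => 0, 𝟙 N, ?_, ?_, inferInstance,
    ⟨by simp, ?_⟩, fun i => ⟨by simp, ?_⟩⟩
  · rintro (_ | i)
    · assumption
    · exact inferInstanceAs (Projective (0 : ModuleCat A))
  · rintro (_ | i) hi
    · omega
    · exact isZero_zero _
  · exact (ShortComplex.exact_iff_mono _ rfl).2 (inferInstanceAs (Mono (𝟙 N)))
  · exact ShortComplex.exact_of_isZero_X₂ _ (isZero_zero _)

/-- Splicing a module with a projective resolution of its first syzygy: the terms. -/
def consObj (P₀ : ModuleCat.{u} A) (P : ℕ → ModuleCat.{u} A) : ℕ → ModuleCat.{u} A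
  | 0 => P₀
  | i + 1 => P i

/-- Splicing a module with a projective resolution of its first syzygy: the differentials. -/
def consHom {P₀ : ModuleCat.{u} A} {P : ℕ → ModuleCat.{u} A} (f : P 0 ⟶ P₀)
    (d : ∀ i, P (i + 1) ⟶ P i) : ∀ i, consObj P₀ P (i + 1) ⟶ consObj P₀ P i
  | 0 => f
  | i + 1 => d i

lemma projDimLE_succ {S : ShortComplex (ModuleCat.{u} A)} (hS : S.ShortExact)
    (h₂ : Projective S.X₂) (r : ℕ) (h : ProjDimLE A S.X₁ r) : ProjDimLE A S.X₃ (r + 1) := by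
  obtain ⟨P, d, f, hP, hz, hf, ⟨w, hex⟩, hex'⟩ := h
  have := hS.mono_f
  refine ⟨consObj S.X₂ P, consHom (f ≫ S.f) d, S.g, ?_, ?_, hS.epi_g,
    ⟨?_, ?_⟩, ?_⟩
  · rintro (_ | i)
    · exact h₂
    · exact hP i
  · rintro (_ | i) hi
    · omega
    · exact hz i (by lia)
  · change (f ≫ S.f) ≫ S.g = 0
    simp
  · have h1 := hS.exact
    rw [ShortComplex.moduleCat_exact_iff] at h1 ⊢
    intro x hx
    obtain ⟨y, hy⟩ := h1 x hx
    obtain ⟨z, hz⟩ := (ModuleCat.epi_iff_surjective f).1 hf y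
    exact ⟨z, (congrArg S.f.hom hz).trans hy⟩
  · rintro (_ | i)
    · refine ⟨?_, ?_⟩
      · change d 0 ≫ f ≫ S.f = 0
        simp [reassoc_of% w]
      rw [ShortComplex.moduleCat_exact_iff] at hex ⊢
      intro x hx
      refine hex x ((ModuleCat.mono_iff_injective S.f).1 this ?_)
      rw [map_zero]
      exact hx
    · exact hex' i

lemma projDimLE_of_hasProjectiveDimensionLT (r : ℕ) (N : ModuleCat.{u} A)
    (h : HasProjectiveDimensionLT N (r + 1)) : ProjDimLE A N r := by
  induction r generalizing N with
  | zero =>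
    have : Projective N := projective_iff_hasProjectiveDimensionLT_one.2 h
    exact projDimLE_zero N
  | succ r ih =>
    have hS : (ShortComplex.mk _ _ (kernel.condition (Projective.π N))).ShortExact :=
      { exact := ShortComplex.exact_kernel _ }
    have hp : Projective (Projective.over N) := inferInstance
    exact projDimLE_succ hS hp r (ih _ ((hS.hasProjectiveDimensionLT_X₃_iff r hp).1 h))

end ProjectiveDimension

section DominantDimension

variable {Λ}
variable {A : Type u} [Ring A] {M : ModuleCat.{u} Λ} (e : A ≃+* (End M)ᵐᵒᵖ)

lemma exists_iso_homFunctor_obj (hM : InAdd Λ M (ModuleCat.of Λ Λ)) (I : ModuleCat.{u} A)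
    [Injective I] [Projective I] :
    ∃ E : ModuleCat.{u} Λ, Injective E ∧ Nonempty (I ≅ (homFunctor e).obj E) := by
  have hI : Module.Projective A I := (IsProjective.iff_projective I).2 inferInstance
  obtain ⟨s, hs⟩ := Module.projective_def'.1 hI
  let E : ModuleCat.{u} Λ := Injective.under M
  let α : ModuleCat.of A A ⟶ (homFunctor e).obj E :=
    (homFunctorSelfIso e).inv ≫ (homFunctor e).map (Injective.ι M)
  have : Mono α := inferInstance
  let ψ (i : I) : I ⟶ (homFunctor e).obj E :=
    ModuleCat.ofHom ((Finsupp.lapply i).comp s : I →ₗ[A] A) ≫ α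
  let Ψ : I ⟶ (homFunctor e).obj (∏ᶜ fun _ : I => E) :=
    Pi.lift ψ ≫ (PreservesProduct.iso (homFunctor e) fun _ : I => E).inv
  have h1 (i : I) : Ψ ≫ (homFunctor e).map (Pi.π (fun _ : I => E) i) = ψ i := by
    have h0 : (PreservesProduct.iso (homFunctor e) fun _ : I => E).inv ≫
        (homFunctor e).map (Pi.π (fun _ : I => E) i) = Pi.π (fun _ : I => (homFunctor e).obj E) i := by
      rw [Iso.inv_comp_eq, PreservesProduct.iso_hom, piComparison_comp_π]
    simp only [Ψ, Category.assoc, h0, Pi.lift_π]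
  have h2 : Mono Ψ := by
    rw [ModuleCat.mono_iff_injective, ← LinearMap.ker_eq_bot, LinearMap.ker_eq_bot']
    intro x hx
    have h3 : s x = 0 := by
      ext i
      have h4 := ConcreteCategory.congr_hom (h1 i) x
      have h5 : (ψ i).hom x = 0 := by
        rw [← h1 i]
        simp only [ModuleCat.hom_comp, LinearMap.comp_apply]
        rw [hx, map_zero]
      exact (ModuleCat.mono_iff_injective α).1 this (h5.trans (map_zero α.hom).symm)
    have h6 := LinearMap.congr_fun hs x
    simp only [LinearMap.comp_apply, h3, map_zero] at h6
    exact h6.symm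
  exact exists_injective_of_retract e hM
    ⟨Ψ, Injective.factorThru (𝟙 I) Ψ, Injective.comp_factorThru _ _⟩

lemma epi_of_isSeparator_of_lift (hM : IsSeparator M) {X K : ModuleCat.{u} Λ} (p : X ⟶ K)
    (h : ∀ f : M ⟶ K, ∃ g : M ⟶ X, g ≫ p = f) : Epi p := by
  refine ⟨fun u v huv => (isSeparator_def M).1 hM _ _ fun f => ?_⟩
  obtain ⟨g, rfl⟩ := h f
  simp [huv]

lemma ext_one_subsingleton_of_copresentation [HasExt.{u} (ModuleCat.{u} Λ)] (hM : IsSeparator M)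
    {E₀ E₁ E₂ : ModuleCat.{u} Λ} [Injective E₀] (φ : M ⟶ E₀) [Mono φ] (γ₀ : E₀ ⟶ E₁) (γ₁ : E₁ ⟶ E₂)
    (w₀ : φ ≫ γ₀ = 0) (w₁ : γ₀ ≫ γ₁ = 0)
    (h₀ : ∀ x : M ⟶ E₀, x ≫ γ₀ = 0 → ∃ y : M ⟶ M, y ≫ φ = x)
    (h₁ : ∀ x : M ⟶ E₁, x ≫ γ₁ = 0 → ∃ y : M ⟶ E₀, y ≫ γ₀ = x) :
    Subsingleton (Abelian.Ext M M 1) := by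
  have hS : (ShortComplex.mk _ _ (cokernel.condition φ)).ShortExact :=
    { exact := ShortComplex.exact_cokernel φ }
  have hepi : Epi (kernel.lift γ₀ φ w₀) := epi_of_isSeparator_of_lift hM _ fun f => by
    obtain ⟨y, hy⟩ := h₀ (f ≫ kernel.ι γ₀) (by simp)
    exact ⟨y, by rw [← cancel_mono (kernel.ι γ₀)]; simpa using hy⟩
  have hex : (ShortComplex.mk φ γ₀ w₀).Exact := by
    rw [ShortComplex.exact_iff_epi_kernel_lift]
    exact hepi
  have hmono : Mono (cokernel.desc φ γ₀ w₀) := hex.mono_cokernelDesc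
  refine subsingleton_of_forall_eq 0 fun x => ?_
  obtain ⟨x₃, rfl⟩ := Abelian.Ext.covariant_sequence_exact₁ M hS x
    (Abelian.Ext.eq_zero_of_injective _) (zero_add 1)
  obtain ⟨f, rfl⟩ := (Abelian.Ext.mk₀_bijective _ _).2 x₃
  obtain ⟨y, hy⟩ := h₁ (f ≫ cokernel.desc φ γ₀ w₀) (by
    rw [Category.assoc, show cokernel.desc φ γ₀ w₀ ≫ γ₁ = 0 by
      rw [← cancel_epi (cokernel.π φ)]; simp [w₁], comp_zero])
  have hf : f = y ≫ cokernel.π φ := by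
    rw [← cancel_mono (cokernel.desc φ γ₀ w₀)]
    simpa using hy.symm
  subst hf
  rw [← Abelian.Ext.mk₀_comp_mk₀, Abelian.Ext.comp_assoc_of_second_deg_zero]
  rw [hS.comp_extClass, Abelian.Ext.comp_zero]

include e in
lemma ext_one_subsingleton_of_domdimGE [HasExt.{u} (ModuleCat.{u} Λ)]
    (hM : InAdd Λ M (ModuleCat.of Λ Λ)) (r : ℕ) (hr : 3 ≤ r) (h : DomdimGE A r) :
    Subsingleton (Abelian.Ext M M 1) := by
  have := homFunctor_faithful e hM
  have := homFunctor_full e hM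
  obtain ⟨I, f, g, hf, hI, h₀, h₁⟩ := h
  obtain ⟨w₀, h₀⟩ := h₀ (by lia)
  obtain ⟨w₁, h₁⟩ := h₁ 0 hr
  have key (i : ℕ) (hi : i < r) := by
    have := (hI i hi).1
    have := (hI i hi).2
    exact exists_iso_homFunctor_obj e hM (I i)
  obtain ⟨E₀, hE₀, ⟨α₀⟩⟩ := key 0 (by lia)
  obtain ⟨E₁, hE₁, ⟨α₁⟩⟩ := key 1 (by lia)
  obtain ⟨E₂, hE₂, ⟨α₂⟩⟩ := key 2 (by lia)
  obtain ⟨φ, hφ⟩ := (homFunctor e).map_surjective ((homFunctorSelfIso e).hom ≫ f ≫ α₀.hom)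
  obtain ⟨γ₀, hγ₀⟩ := (homFunctor e).map_surjective (α₀.inv ≫ g 0 ≫ α₁.hom)
  obtain ⟨γ₁, hγ₁⟩ := (homFunctor e).map_surjective (α₁.inv ≫ g 1 ≫ α₂.hom)
  have : Mono φ := (homFunctor e).mono_of_mono_map (by rw [hφ]; infer_instance)
  have v₀ : φ ≫ γ₀ = 0 := (homFunctor e).map_injective (by
    rw [Functor.map_comp, hφ, hγ₀]; simp [reassoc_of% w₀])
  have v₁ : γ₀ ≫ γ₁ = 0 := (homFunctor e).map_injective (by
    rw [Functor.map_comp, hγ₀, hγ₁]; simp [reassoc_of% w₁])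
  have k₀ : (ShortComplex.mk φ γ₀ v₀ |>.map (homFunctor e)).Exact :=
    (ShortComplex.exact_iff_of_iso (ShortComplex.isoMk (homFunctorSelfIso e).symm α₀ α₁
      (by change (homFunctorSelfIso e).inv ≫ (homFunctor e).map φ = f ≫ α₀.hom
          rw [hφ, Iso.inv_hom_id_assoc])
      (by change α₀.hom ≫ (homFunctor e).map γ₀ = g 0 ≫ α₁.hom
          rw [hγ₀, Iso.hom_inv_id_assoc]))).1 h₀
  have k₁ : (ShortComplex.mk γ₀ γ₁ v₁ |>.map (homFunctor e)).Exact :=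
    (ShortComplex.exact_iff_of_iso (ShortComplex.isoMk α₀ α₁ α₂
      (by change α₀.hom ≫ (homFunctor e).map γ₀ = g 0 ≫ α₁.hom
          rw [hγ₀, Iso.hom_inv_id_assoc])
      (by change α₁.hom ≫ (homFunctor e).map γ₁ = g 1 ≫ α₂.hom
          rw [hγ₁, Iso.hom_inv_id_assoc]))).1 h₁
  rw [ShortComplex.moduleCat_exact_iff] at k₀ k₁
  exact ext_one_subsingleton_of_copresentation (isSeparator_of_inAdd hM) φ γ₀ γ₁ v₀ v₁
    (fun x hx => k₀ (elemOfHom e x) hx) (fun x hx => k₁ (elemOfHom e x) hx)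

end DominantDimension

section GlobalDimension

variable {A : Type u} [Ring A]

lemma ideal_shortExact (I : Ideal A) :
    (ModuleCat.shortComplexOfCompEqZero I.subtype I.mkQ (by ext; simp)).ShortExact :=
  ModuleCat.shortComplex_shortExact _
    (by rw [LinearMap.exact_iff]; simp [ModuleCat.shortComplexOfCompEqZero])
    I.injective_subtype I.mkQ_surjective

lemma injective_of_ext_quotient [HasExt.{u} (ModuleCat.{u} A)] (C : ModuleCat.{u} A)
    (h : ∀ I : Ideal A, Subsingleton (Abelian.Ext (ModuleCat.of A (A ⧸ I)) C 1)) :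
    Injective C := by
  rw [← Module.injective_iff_injective_object]
  refine Module.Baer.injective fun I g => ?_
  obtain ⟨x, hx⟩ := Abelian.Ext.contravariant_sequence_exact₁ (ideal_shortExact I) C
    (Abelian.Ext.mk₀ (ModuleCat.ofHom g)) (add_zero 1) ((h I).elim _ _)
  obtain ⟨f, rfl⟩ := (Abelian.Ext.mk₀_bijective _ _).2 x
  rw [Abelian.Ext.mk₀_comp_mk₀] at hx
  have hx' := (Abelian.Ext.mk₀_bijective _ _).1 hx
  exact ⟨f.hom, fun x hxI => ConcreteCategory.congr_hom hx' ⟨x, hxI⟩⟩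

lemma ext_eq_zero_of_quotients [HasExt.{u} (ModuleCat.{u} A)] (d : ℕ) (B : ModuleCat.{u} A)
    (h : ∀ I : Ideal A, Subsingleton (Abelian.Ext (ModuleCat.of A (A ⧸ I)) B (d + 1)))
    (N : ModuleCat.{u} A) (x : Abelian.Ext N B (d + 1)) : x = 0 := by
  induction d generalizing B with
  | zero =>
    have := injective_of_ext_quotient B h
    exact Abelian.Ext.eq_zero_of_injective x
  | succ d ih =>
    have hS : (ShortComplex.mk _ _ (cokernel.condition (Injective.ι B))).ShortExact :=
      { exact := ShortComplex.exact_cokernel _ }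
    obtain ⟨y, rfl⟩ := Abelian.Ext.covariant_sequence_exact₁ N hS x
      (Abelian.Ext.eq_zero_of_injective _) rfl
    rw [ih _ (fun I => subsingleton_of_forall_eq 0 fun z => ?_) y, Abelian.Ext.zero_comp]
    obtain ⟨w, rfl⟩ := Abelian.Ext.covariant_sequence_exact₃ _ hS z rfl ((h I).elim _ _)
    rw [show w = 0 from Abelian.Ext.eq_zero_of_injective (I := Injective.under B) w,
      Abelian.Ext.zero_comp]

lemma gldimLE_of_quotients (d : ℕ)
    (h : ∀ I : Ideal A, HasProjectiveDimensionLT (ModuleCat.of A (A ⧸ I)) (d + 1)) :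
    GldimLE A d := by
  intro N
  refine projDimLE_of_hasProjectiveDimensionLT d N ?_
  refine hasProjectiveDimensionLT_of_enoughInjectives N _ fun Y =>
    subsingleton_of_forall_eq 0 fun x => ext_eq_zero_of_quotients d Y (fun I => ?_) N x
  have := h I
  exact HasProjectiveDimensionLT.subsingleton _ (d + 1) _ le_rfl _

end GlobalDimension

section Auslander

variable {Λ}
variable {A : Type u} [Ring A] {M : ModuleCat.{u} Λ} (e : A ≃+* (End M)ᵐᵒᵖ)

lemma hasProjectiveDimensionLT_three {X Y : ModuleCat.{u} Λ} (hX : InAdd Λ M X) (hY : InAdd Λ M Y)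
    (ψ : X ⟶ Y) (hK : InAdd Λ M (kernel ψ)) {Q : ModuleCat.{u} A} (p : (homFunctor e).obj Y ⟶ Q)
    [Epi p] (w : (homFunctor e).map ψ ≫ p = 0)
    (hex : (ShortComplex.mk _ _ w).Exact) : HasProjectiveDimensionLT Q 3 := by
  have := projective_homFunctor_obj e hX
  have := projective_homFunctor_obj e hY
  have := projective_homFunctor_obj e hK
  have hS₁ : (ShortComplex.mk _ _ (kernel.condition p)).ShortExact :=
    { exact := ShortComplex.exact_kernel p }
  have w₂ : (homFunctor e).map (kernel.ι ψ) ≫ kernel.lift p ((homFunctor e).map ψ) w = 0 := by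
    rw [← cancel_mono (kernel.ι p), Category.assoc, kernel.lift_ι, ← Functor.map_comp,
      kernel.condition, Functor.map_zero, zero_comp]
  have hS₂ : (ShortComplex.mk _ _ w₂).ShortExact := by
    refine { exact := ?_, mono_f := homFunctor_mono e _, epi_g := hex.epi_kernelLift }
    have h1 := homFunctor_map_exact e (S := ShortComplex.mk _ _ (kernel.condition ψ))
      (ShortComplex.exact_kernel ψ)
    rw [ShortComplex.moduleCat_exact_iff] at h1 ⊢
    intro x hx
    refine h1 x ?_
    have h2 : (homFunctor e).map ψ = kernel.lift p ((homFunctor e).map ψ) w ≫ kernel.ι p := by simp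
    refine (ConcreteCategory.congr_hom h2 x).trans ?_
    exact (congrArg (kernel.ι p).hom hx).trans (map_zero _)
  exact hS₁.hasProjectiveDimensionLT_X₃ 2
    (hS₂.hasProjectiveDimensionLT_X₃ 1
      (inferInstanceAs (HasProjectiveDimensionLT ((homFunctor e).obj (kernel ψ)) 1))
      (inferInstanceAs (HasProjectiveDimensionLT ((homFunctor e).obj X) 2)))
    (inferInstanceAs (HasProjectiveDimensionLT ((homFunctor e).obj Y) 3))

include e in
lemma hasProjectiveDimensionLT_three_quotient
    (hK : ∀ (r : ℕ) (ψ : (⨁ fun _ : Fin r => M) ⟶ M), InAdd Λ M (kernel ψ))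
    (I : Ideal A) (hI : I.FG) : HasProjectiveDimensionLT (ModuleCat.of A (A ⧸ I)) 3 := by
  obtain ⟨r, s, rfl⟩ := Submodule.fg_iff_exists_fin_generating_family.1 hI
  let ψ : (⨁ fun _ : Fin r => M) ⟶ M := biproduct.desc fun j => (e (s j)).unop
  let p : (homFunctor e).obj M ⟶ ModuleCat.of A (A ⧸ Submodule.span A (Set.range s)) :=
    (homFunctorSelfIso e).hom ≫ ModuleCat.ofHom (Submodule.mkQ _)
  have hp : Epi p := by
    have : Epi (ModuleCat.ofHom (Submodule.mkQ (Submodule.span A (Set.range s)))) :=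
      (ModuleCat.epi_iff_surjective _).2 (Submodule.mkQ_surjective _)
    exact epi_comp _ _
  have hpz (x : M ⟶ M) : p.hom (elemOfHom e x) = 0 ↔
      e.symm (MulOpposite.op x) ∈ Submodule.span A (Set.range s) :=
    Submodule.Quotient.mk_eq_zero _
  have w : (homFunctor e).map ψ ≫ p = 0 := by
    ext (x : M ⟶ _)
    refine (hpz (x ≫ ψ)).2 ?_
    have : e.symm (MulOpposite.op (x ≫ ψ : End M)) =
        ∑ j, e.symm (MulOpposite.op (x ≫ biproduct.π _ j : End M)) * s j := by
      apply e.injective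
      rw [RingEquiv.apply_symm_apply, map_sum]
      simp only [map_mul, RingEquiv.apply_symm_apply]
      apply MulOpposite.unop_injective
      rw [Finset.unop_sum]
      change x ≫ ψ = ∑ j, (x ≫ biproduct.π _ j) ≫ (e (s j)).unop
      simp [ψ, biproduct.desc_eq, Preadditive.comp_sum]
    rw [this]
    exact Submodule.sum_mem _ fun j _ => Submodule.smul_mem _ _ (Submodule.subset_span ⟨j, rfl⟩)
  refine hasProjectiveDimensionLT_three e (inAdd_iff.2 ⟨r, ⟨Retract.refl _⟩⟩)
    (inAdd_self M) ψ (hK r ψ) p w ?_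
  rw [ShortComplex.moduleCat_exact_iff]
  intro (x : M ⟶ M) hx
  obtain ⟨c, hc⟩ := (Submodule.mem_span_range_iff_exists_fun A).1 ((hpz x).1 hx)
  refine ⟨elemOfHom e (biproduct.lift fun j => (e (c j)).unop), ?_⟩
  change biproduct.lift (fun j => (e (c j)).unop) ≫ ψ = x
  have h1 := congrArg (fun a => (e a).unop) hc
  simp only [RingEquiv.apply_symm_apply, smul_eq_mul, map_sum, map_mul, Finset.unop_sum] at h1
  refine Eq.trans ?_ h1
  simp only [ψ, biproduct.lift_desc]
  rfl

end Auslander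

section Auslander

variable {Λ}
variable {A : Type u} [Ring A] {M : ModuleCat.{u} Λ} (e : A ≃+* (End M)ᵐᵒᵖ)
variable (k : Type u) [Field k] [Algebra k Λ] [FiniteDimensional k Λ]

/-- Multiplication by a scalar, as a module endomorphism. -/
def scalarHom (M : ModuleCat.{u} Λ) (c : k) : M ⟶ M :=
  ModuleCat.ofHom
    { toFun := fun x => algebraMap k Λ c • x
      map_add' := smul_add _
      map_smul' := fun a x => by
        rw [RingHom.id_apply, ← mul_smul, ← mul_smul, Algebra.commutes] }

include e k in
lemma isNoetherianRing_of_end [Module.Finite Λ M] : IsNoetherianRing A := by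
  let : Module k M := Module.compHom M (algebraMap k Λ)
  have : IsScalarTower k Λ M := ⟨fun c a x => by
    rw [Algebra.smul_def, mul_smul]; rfl⟩
  have : Module.Finite k M := Module.Finite.trans Λ M
  let φ : k →+* A :=
    { toFun := fun c => e.symm (MulOpposite.op (scalarHom k M c : End M))
      map_one' := by
        rw [← map_one e.symm]
        congr 2
        refine ModuleCat.hom_ext (LinearMap.ext fun x => ?_)
        change algebraMap k Λ 1 • x = x
        rw [map_one, one_smul]
      map_mul' := fun c d => by
        rw [← map_mul e.symm, ← MulOpposite.op_mul]
        congr 2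
        refine ModuleCat.hom_ext (LinearMap.ext fun x => ?_)
        change algebraMap k Λ (c * d) • x = algebraMap k Λ d • algebraMap k Λ c • x
        rw [mul_comm, map_mul, mul_smul]
      map_zero' := by
        rw [← map_zero e.symm]
        congr 2
        refine ModuleCat.hom_ext (LinearMap.ext fun x => ?_)
        change algebraMap k Λ 0 • x = 0
        rw [map_zero, zero_smul]
      map_add' := fun c d => by
        rw [← map_add e.symm, ← MulOpposite.op_add]
        congr 2
        refine ModuleCat.hom_ext (LinearMap.ext fun x => ?_)
        change algebraMap k Λ (c + d) • x = algebraMap k Λ c • x + algebraMap k Λ d • x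
        rw [map_add, add_smul] }
  let : Module k A := Module.compHom A φ
  have : IsScalarTower k A A := ⟨fun c a x => mul_assoc (φ c) a x⟩
  let ι : A →ₗ[k] M →ₗ[k] M :=
    { toFun := fun a =>
        { toFun := fun x => (e a).unop.hom x
          map_add' := map_add _
          map_smul' := fun c x => map_smul _ (algebraMap k Λ c) x }
      map_add' := fun a b => by
        ext x
        change (e (a + b)).unop.hom x = (e a).unop.hom x + (e b).unop.hom x
        rw [map_add]; rfl
      map_smul' := fun c a => by
        ext x
        change (e (φ c * a)).unop.hom x = algebraMap k Λ c • (e a).unop.hom x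
        have h : e (φ c) = MulOpposite.op (scalarHom k M c : End M) := e.apply_symm_apply _
        rw [map_mul, h]
        exact (e a).unop.hom.map_smul (algebraMap k Λ c) x }
  have hι : Function.Injective ι := fun a b h => by
    apply e.injective
    apply MulOpposite.unop_injective
    refine ModuleCat.hom_ext (LinearMap.ext fun x => ?_)
    exact LinearMap.congr_fun h x
  have : Module.Finite k A := Module.Finite.of_injective ι hι
  exact isNoetherian_of_tower k inferInstance

include e k in
lemma gldimLE_two_of_forall_inAdd [Module.Finite Λ M]
    (hM : ∀ X : ModuleCat.{u} Λ, Module.Finite Λ X → InAdd Λ M X) : GldimLE A 2 := by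
  have := isNoetherianRing_of_end e k
  have : IsNoetherianRing Λ := isNoetherian_of_tower k inferInstance
  refine gldimLE_of_quotients 2 fun I => hasProjectiveDimensionLT_three_quotient e
    (fun r ψ => hM _ ?_) I (IsNoetherian.noetherian I)
  have h1 : Module.Finite Λ (ModuleCat.of Λ (Fin r → M)) :=
    inferInstanceAs (Module.Finite Λ (Fin r → M))
  have h2 : Module.Finite Λ (⨁ fun _ : Fin r => M : ModuleCat Λ) :=
    Module.Finite.equiv (ModuleCat.biproductIsoPi fun _ : Fin r => M).toLinearEquiv.symm
  exact Module.Finite.of_injective (kernel.ι ψ).hom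
    ((ModuleCat.mono_iff_injective _).1 inferInstance)

include e in
lemma domdimGE_two (hΛ : InAdd Λ M (ModuleCat.of Λ Λ)) {E₀ E₁ : ModuleCat.{u} Λ} [Injective E₀]
    [Injective E₁] (h₀ : InAdd Λ M E₀) (h₁ : InAdd Λ M E₁) (φ : M ⟶ E₀) [Mono φ] (ψ : E₀ ⟶ E₁)
    (w : φ ≫ ψ = 0) (hex : (ShortComplex.mk φ ψ w).Exact) : DomdimGE A 2 := by
  have := homFunctor_preservesInjectiveObjects e hΛ
  have hP₀ := projective_homFunctor_obj e h₀
  have hP₁ := projective_homFunctor_obj e h₁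
  have hI₀ : Injective ((homFunctor e).obj E₀) := inferInstance
  have hI₁ : Injective ((homFunctor e).obj E₁) := inferInstance
  have hmap := homFunctor_map_exact e hex
  have hw : ((homFunctorSelfIso e).inv ≫ (homFunctor e).map φ) ≫ (homFunctor e).map ψ = 0 := by
    rw [Category.assoc, ← CategoryTheory.Functor.map_comp, w, Functor.map_zero, comp_zero]
  have hex' : (ShortComplex.mk _ _ hw).Exact :=
    ShortComplex.exact_of_iso (S₁ := (ShortComplex.mk φ ψ w).map (homFunctor e))
      (ShortComplex.isoMk (homFunctorSelfIso e) (Iso.refl _) (Iso.refl _)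
        ((Iso.hom_inv_id_assoc _ _).trans (Category.comp_id _).symm)
        ((Category.id_comp _).trans (Category.comp_id _).symm)) hmap
  refine ⟨fun i => Nat.casesOn i ((homFunctor e).obj E₀) fun _ => (homFunctor e).obj E₁,
    (homFunctorSelfIso e).inv ≫ (homFunctor e).map φ,
    fun i => Nat.casesOn i ((homFunctor e).map ψ) fun _ => 0, mono_comp _ _, ?_,
    fun _ => ⟨hw, hex'⟩, fun i hi => by lia⟩
  rintro (_ | i) _
  exacts [⟨hI₀, hP₀⟩, ⟨hI₁, hP₁⟩]

end Auslander

section Length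

variable {X Y Z : Type u} [AddCommGroup X] [Module Λ X] [AddCommGroup Y] [Module Λ Y]
  [AddCommGroup Z] [Module Λ Z]

/-- The composition length as a natural number. -/
noncomputable def len (X : Type u) [AddCommGroup X] [Module Λ X] : ℕ := (Module.length Λ X).toNat

/-- The submodules form a chain. -/
def Uniserial (X : Type u) [AddCommGroup X] [Module Λ X] : Prop :=
  ∀ N₁ N₂ : Submodule Λ X, N₁ ≤ N₂ ∨ N₂ ≤ N₁

lemma len_congr (e : X ≃ₗ[Λ] Y) : len Λ X = len Λ Y := by
  rw [len, e.length_eq, len]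

variable {Λ}

lemma len_top : len Λ (⊤ : Submodule Λ X) = len Λ X := len_congr Λ Submodule.topEquiv

lemma len_range_of_surjective (f : X →ₗ[Λ] Y) (hf : Function.Surjective f) :
    len Λ (LinearMap.range f) = len Λ Y := by
  rw [LinearMap.range_eq_top.2 hf, len_top]

lemma Uniserial.of_injective (hY : Uniserial Λ Y) (f : X →ₗ[Λ] Y) (hf : Function.Injective f) :
    Uniserial Λ X := fun N N' => by
  rcases hY (N.map f) (N'.map f) with h | h
  · exact Or.inl ((Submodule.map_le_map_iff_of_injective hf _ _).1 h)
  · exact Or.inr ((Submodule.map_le_map_iff_of_injective hf _ _).1 h)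

lemma Uniserial.of_surjective (hX : Uniserial Λ X) (f : X →ₗ[Λ] Y) (hf : Function.Surjective f) :
    Uniserial Λ Y := fun N N' => by
  rcases hX (N.comap f) (N'.comap f) with h | h
  · exact Or.inl ((Submodule.comap_le_comap_iff_of_surjective hf).1 h)
  · exact Or.inr ((Submodule.comap_le_comap_iff_of_surjective hf).1 h)

lemma Uniserial.eq_top_of_sup (hX : Uniserial Λ X) {N N' : Submodule Λ X} (h : N ⊔ N' = ⊤) :
    N = ⊤ ∨ N' = ⊤ := by
  rcases hX N N' with h' | h'
  · exact Or.inr ((sup_eq_right.2 h').symm.trans h)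
  · exact Or.inl ((sup_eq_left.2 h').symm.trans h)

/-- A map whose image of a submodule is everything is onto from that submodule,
provided the target is nonzero. -/
lemma Uniserial.eq_top_of_map_eq_range (hX : Uniserial Λ X) (f : X →ₗ[Λ] Y) (hf : f ≠ 0)
    {N : Submodule Λ X} (h : N.map f = LinearMap.range f) : N = ⊤ := by
  have h1 : N ⊔ LinearMap.ker f = ⊤ := by
    rw [← Submodule.comap_map_eq, h, LinearMap.range_eq_map, Submodule.comap_map_eq]
    simp
  exact (hX.eq_top_of_sup h1).resolve_right fun h2 => hf (LinearMap.ker_eq_top.1 h2)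

/-- Lifting through a surjection from a uniserial module inside the range. -/
lemma Uniserial.surjective_of_comp (hX : Uniserial Λ X) (f : X →ₗ[Λ] Y) (hf : f ≠ 0)
    (g : Z →ₗ[Λ] X) (h : LinearMap.range (f ∘ₗ g) = LinearMap.range f) : Function.Surjective g :=
  LinearMap.range_eq_top.1 (hX.eq_top_of_map_eq_range f hf (by rw [← LinearMap.range_comp, h]))

variable [IsArtinianRing Λ]

lemma coe_len [Module.Finite Λ X] : (len Λ X : ℕ∞) = Module.length Λ X :=
  ENat.natCast_toNat Module.length_ne_top

lemma len_add_of_exact [Module.Finite Λ X] [Module.Finite Λ Y] [Module.Finite Λ Z]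
    (f : X →ₗ[Λ] Y) (g : Y →ₗ[Λ] Z) (hf : Function.Injective f) (hg : Function.Surjective g)
    (h : Function.Exact f g) : len Λ Y = len Λ X + len Λ Z := by
  have := Module.length_eq_add_of_exact f g hf hg h
  rw [← coe_len, ← coe_len, ← coe_len] at this
  exact_mod_cast this

lemma len_eq_zero_iff [Module.Finite Λ X] : len Λ X = 0 ↔ Subsingleton X := by
  rw [← Module.length_eq_zero_iff (R := Λ), ← coe_len, Nat.cast_eq_zero]

lemma len_eq_one_iff [Module.Finite Λ X] : len Λ X = 1 ↔ IsSimpleModule Λ X := by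
  rw [← Module.length_eq_one_iff, ← coe_len, Nat.cast_eq_one]

lemma len_submodule_add_quotient [Module.Finite Λ X] (N : Submodule Λ X) :
    len Λ X = len Λ N + len Λ (X ⧸ N) :=
  len_add_of_exact N.subtype N.mkQ N.injective_subtype N.mkQ_surjective
    (LinearMap.exact_subtype_mkQ N)

lemma len_ker_add_range [Module.Finite Λ X] (f : X →ₗ[Λ] Y) :
    len Λ X = len Λ (LinearMap.ker f) + len Λ (LinearMap.range f) := by
  rw [len_submodule_add_quotient (LinearMap.ker f), len_congr Λ f.quotKerEquivRange]

lemma len_le_of_injective [Module.Finite Λ X] [Module.Finite Λ Y] (f : X →ₗ[Λ] Y)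
    (hf : Function.Injective f) : len Λ X ≤ len Λ Y := by
  have := Module.length_le_of_injective f hf
  rw [← coe_len, ← coe_len] at this
  exact_mod_cast this

lemma len_le_of_surjective [Module.Finite Λ X] [Module.Finite Λ Y] (f : X →ₗ[Λ] Y)
    (hf : Function.Surjective f) : len Λ Y ≤ len Λ X := by
  have := Module.length_le_of_surjective f hf
  rw [← coe_len, ← coe_len] at this
  exact_mod_cast this

lemma len_submodule_le [Module.Finite Λ X] (N : Submodule Λ X) : len Λ N ≤ len Λ X :=
  len_le_of_injective N.subtype N.injective_subtype

lemma eq_top_of_len [Module.Finite Λ X] {N : Submodule Λ X} (h : len Λ X ≤ len Λ N) : N = ⊤ := by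
  have := len_submodule_add_quotient N
  have h0 : len Λ (X ⧸ N) = 0 := by lia
  rw [len_eq_zero_iff] at h0
  exact Submodule.Quotient.subsingleton_iff.1 h0

lemma len_map_le [Module.Finite Λ X] (f : X →ₗ[Λ] Y) (N : Submodule Λ X) :
    len Λ (N.map f) ≤ len Λ N := by
  have h := len_ker_add_range (f ∘ₗ N.subtype)
  rw [LinearMap.range_comp, Submodule.range_subtype] at h
  lia

lemma eq_of_le_of_len [Module.Finite Λ X] {N N' : Submodule Λ X} (h : N ≤ N')
    (h' : len Λ N' ≤ len Λ N) : N = N' := by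
  have h1 : N.submoduleOf N' = ⊤ := eq_top_of_len (by
    rwa [len_congr Λ (Submodule.submoduleOfEquivOfLe h)])
  exact h.antisymm (Submodule.submoduleOf_eq_top.1 h1)

lemma injective_of_surjective_of_len [Module.Finite Λ X] (f : X →ₗ[Λ] Y)
    (hf : Function.Surjective f) (h : len Λ X ≤ len Λ Y) : Function.Injective f := by
  have h1 := len_ker_add_range f
  rw [len_range_of_surjective f hf] at h1
  have h2 : len Λ (LinearMap.ker f) = 0 := by lia
  exact LinearMap.ker_eq_bot.1 ((Submodule.subsingleton_iff_eq_bot).1 (len_eq_zero_iff.1 h2))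

lemma Uniserial.le_of_len [Module.Finite Λ X] (hX : Uniserial Λ X) {N N' : Submodule Λ X}
    (h : len Λ N ≤ len Λ N') : N ≤ N' :=
  (hX N N').elim id fun h' => (eq_of_le_of_len h' h).ge

end Length

section ProjectiveCovers

variable {Λ}

lemma finite_of_iso {X Y : ModuleCat.{u} Λ} (e : X ≅ Y) (h : Module.Finite Λ X) :
    Module.Finite Λ Y := Module.Finite.equiv e.toLinearEquiv

lemma isZero_iff_subsingleton {X : ModuleCat.{u} Λ} : IsZero X ↔ Subsingleton X :=
  ModuleCat.isZero_iff_subsingleton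

lemma len_biprod [IsArtinianRing Λ] (A B : ModuleCat.{u} Λ) [Module.Finite Λ A]
    [Module.Finite Λ B] : len Λ (A ⊞ B : ModuleCat Λ) = len Λ A + len Λ B := by
  rw [len_congr Λ (ModuleCat.biprodIsoProd A B).toLinearEquiv]
  exact len_add_of_exact (LinearMap.inl Λ A B) (LinearMap.snd Λ A B) LinearMap.inl_injective
    LinearMap.snd_surjective Function.Exact.inl_snd

lemma fg_induction [IsArtinianRing Λ] (Q : ModuleCat.{u} Λ → Prop)
    (iso : ∀ X Y : ModuleCat.{u} Λ, (X ≅ Y) → Q X → Q Y)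
    (zero : ∀ X : ModuleCat.{u} Λ, IsZero X → Q X)
    (sum : ∀ X Y : ModuleCat.{u} Λ, Q X → Q Y → Q (X ⊞ Y))
    (indec : ∀ X : ModuleCat.{u} Λ, Module.Finite Λ X → Indec Λ X → Q X)
    (X : ModuleCat.{u} Λ) (hX : Module.Finite Λ X) : Q X := by
  induction h : len Λ X using Nat.strong_induction_on generalizing X with
  | _ d ih =>
    subst h
    by_cases hz : IsZero X
    · exact zero X hz
    by_cases hi : Indec Λ X
    · exact indec X hX hi
    simp only [Indec, not_and, not_forall, not_or] at hi
    obtain ⟨A, B, ⟨e⟩, hA, hB⟩ := hi hz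
    have hAB := finite_of_iso e hX
    have hfA : Module.Finite Λ A :=
      Module.Finite.of_surjective (biprod.fst : A ⊞ B ⟶ A).hom
        ((ModuleCat.epi_iff_surjective _).1 inferInstance)
    have hfB : Module.Finite Λ B :=
      Module.Finite.of_surjective (biprod.snd : A ⊞ B ⟶ B).hom
        ((ModuleCat.epi_iff_surjective _).1 inferInstance)
    have hl : len Λ X = len Λ A + len Λ B := by
      rw [len_congr Λ e.toLinearEquiv, len_biprod]
    rw [isZero_iff_subsingleton, ← len_eq_zero_iff (Λ := Λ)] at hA hB
    exact iso _ _ e.symm (sum A B (ih _ (by lia) A hfA rfl) (ih _ (by lia) B hfB rfl))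

/-- An indecomposable projective-injective module. -/
structure IsPI (P : ModuleCat.{u} Λ) : Prop where
  fin : Module.Finite Λ P
  proj : Projective P
  inj : Injective P
  uni : Uniserial Λ P
  nontriv : Nontrivial P

lemma IsPI.of_iso {P Q : ModuleCat.{u} Λ} (h : IsPI P) (e : P ≅ Q) : IsPI Q where
  fin := finite_of_iso e h.fin
  proj := have := h.proj; Projective.of_iso e inferInstance
  inj := have := h.inj; Injective.of_iso e inferInstance
  uni := h.uni.of_surjective e.toLinearEquiv.toLinearMap e.toLinearEquiv.surjective
  nontriv := have := h.nontriv; e.toLinearEquiv.symm.toEquiv.nontrivial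

/-- Any map from a projective module lifts along a map whose range is big enough. -/
lemma exists_lift_of_range_le {P X Y : ModuleCat.{u} Λ} [Projective P] (f : P ⟶ Y) (g : X ⟶ Y)
    (h : LinearMap.range f.hom ≤ LinearMap.range g.hom) : ∃ t : P ⟶ X, t ≫ g = f := by
  have hP : Module.Projective Λ P := (IsProjective.iff_projective P).2 inferInstance
  obtain ⟨t, ht⟩ := Module.projective_lifting_property g.hom.rangeRestrict
    (f.hom.codRestrict _ fun x => h ⟨x, rfl⟩) g.hom.surjective_rangeRestrict
  refine ⟨ModuleCat.ofHom t, ModuleCat.hom_ext (LinearMap.ext fun x => ?_)⟩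
  exact congrArg Subtype.val (LinearMap.congr_fun ht x)

variable [IsArtinianRing Λ]

lemma IsPI.iso_of_range_eq {P P' Y : ModuleCat.{u} Λ} (hP : IsPI P) (hP' : IsPI P')
    (f : P ⟶ Y) (f' : P' ⟶ Y) (hf : f ≠ 0)
    (h : LinearMap.range f.hom = LinearMap.range f'.hom) : Nonempty (P ≅ P') := by
  have := hP.fin
  have := hP'.fin
  have := hP.proj
  have := hP'.proj
  have hf0 : f.hom ≠ 0 := fun h0 => hf (ModuleCat.hom_ext h0)
  have hf0' : f'.hom ≠ 0 := fun h0 => hf0 (by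
    rw [← LinearMap.range_eq_bot, h, h0, LinearMap.range_zero])
  obtain ⟨t, ht⟩ := exists_lift_of_range_le f f' h.le
  obtain ⟨t', ht'⟩ := exists_lift_of_range_le f' f h.ge
  have hs : Function.Surjective t.hom := hP'.uni.surjective_of_comp f'.hom hf0' t.hom (by
    rw [← h, ← ht]; rfl)
  have hs' : Function.Surjective t'.hom := hP.uni.surjective_of_comp f.hom hf0 t'.hom (by
    rw [h, ← ht']; rfl)
  have hi := injective_of_surjective_of_len t.hom hs (len_le_of_surjective _ hs')
  exact ⟨(LinearEquiv.ofBijective t.hom ⟨hi, hs⟩).toModuleIso⟩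

omit [IsArtinianRing Λ] in
lemma IsPI.surjective_of_injective {P Y : ModuleCat.{u} Λ} (hP : IsPI P)
    (hY : Uniserial Λ Y) (f : P ⟶ Y) (hf : Function.Injective f.hom) :
    Function.Surjective f.hom := by
  have := hP.inj
  have := hP.nontriv
  have : Mono f := (ModuleCat.mono_iff_injective f).2 hf
  obtain ⟨x, hx⟩ := exists_ne (0 : P)
  let r : Y ⟶ P := Injective.factorThru (𝟙 P) f
  have hr : f ≫ r = 𝟙 P := Injective.comp_factorThru _ _
  have hr' (y : P) : r.hom (f.hom y) = y := ConcreteCategory.congr_hom hr y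
  refine hY.surjective_of_comp r.hom (fun h0 => hx ?_) f.hom ?_
  · rw [← hr' x, h0]; rfl
  · have h1 : r.hom ∘ₗ f.hom = LinearMap.id := LinearMap.ext hr'
    rw [h1, LinearMap.range_id, eq_comm, LinearMap.range_eq_top]
    exact fun y => ⟨_, hr' y⟩

lemma exists_cover (hU : ∀ X : ModuleCat.{u} Λ, Module.Finite Λ X → Indec Λ X → Uniserial Λ X)
    (hI : Injective (ModuleCat.of Λ Λ)) (X : ModuleCat.{u} Λ) [Module.Finite Λ X] [Nontrivial X]
    (hX : Uniserial Λ X) :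
    ∃ (P : ModuleCat.{u} Λ) (f : P ⟶ X), IsPI P ∧ Function.Surjective f.hom := by
  have key := fg_induction (Λ := Λ) (fun F => Projective F → Injective F → ∀ f : F ⟶ X,
    Function.Surjective f.hom →
      ∃ (P : ModuleCat.{u} Λ) (f : P ⟶ X), IsPI P ∧ Function.Surjective f.hom)
    (fun F G e h hp hi f hf => h (Projective.of_iso e.symm hp) (Injective.of_iso e.symm hi)
      (e.hom ≫ f) (hf.comp e.toLinearEquiv.surjective))
    (fun F hz hp hi f hf => by
      have := isZero_iff_subsingleton.1 hz
      have := hf.subsingleton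
      exact absurd this (not_subsingleton X))
    (fun F G hF hG hp hi f hf => by
      have h1 : LinearMap.range (biprod.inl ≫ f).hom ⊔ LinearMap.range (biprod.inr ≫ f).hom = ⊤ := by
        rw [eq_top_iff]
        rintro x -
        obtain ⟨y, rfl⟩ := hf x
        have h2 := ConcreteCategory.congr_hom (biprod.total (X := F) (Y := G)) y
        have h3 : f.hom y = (biprod.inl ≫ f).hom ((biprod.fst : F ⊞ G ⟶ F).hom y) +
            (biprod.inr ≫ f).hom ((biprod.snd : F ⊞ G ⟶ G).hom y) := by
          conv_lhs => rw [show y = _ from h2.symm]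
          exact map_add f.hom _ _
        rw [h3]
        exact Submodule.add_mem_sup ⟨_, rfl⟩ ⟨_, rfl⟩
      have rF : Retract F (F ⊞ G) := ⟨biprod.inl, biprod.fst, by simp⟩
      have rG : Retract G (F ⊞ G) := ⟨biprod.inr, biprod.snd, by simp⟩
      rcases hX.eq_top_of_sup h1 with h | h
      · exact hF rF.projective rF.injective _ (LinearMap.range_eq_top.1 h)
      · exact hG rG.projective rG.injective _ (LinearMap.range_eq_top.1 h))
    (fun F hfin hind hp hi f hf => ⟨F, f, ⟨hfin, hp, hi, hU F hfin hind, by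
      by_contra h
      exact hind.1 (isZero_iff_subsingleton.2 (not_nontrivial_iff_subsingleton.1 h))⟩, hf⟩)
  obtain ⟨r, g, hg⟩ := Module.Finite.exists_fin' Λ X
  have e : (⨁ fun _ : Fin r => ModuleCat.of Λ Λ) ≅ ModuleCat.of Λ (Fin r → Λ) :=
    ModuleCat.biproductIsoPi _
  have hfin : Module.Finite Λ (ModuleCat.of Λ (Fin r → Λ)) :=
    inferInstanceAs (Module.Finite Λ (Fin r → Λ))
  have hp : Projective (ModuleCat.of Λ (Fin r → Λ)) :=
    ModuleCat.projective_of_free (Pi.basisFun Λ (Fin r))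
  have hi : Injective (⨁ fun _ : Fin r => ModuleCat.of Λ Λ) := inferInstance
  exact key _ hfin hp (Injective.of_iso e hi) (ModuleCat.ofHom g) hg

end ProjectiveCovers

section Simples

variable {Λ}

lemma exists_factor_of_ker_le {X Y Z : Type u} [AddCommGroup X] [Module Λ X] [AddCommGroup Y]
    [Module Λ Y] [AddCommGroup Z] [Module Λ Z] (f : X →ₗ[Λ] Y) (hf : Function.Surjective f)
    (g : X →ₗ[Λ] Z) (h : LinearMap.ker f ≤ LinearMap.ker g) : ∃ t : Y →ₗ[Λ] Z, t ∘ₗ f = g := by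
  refine ⟨(LinearMap.ker f).liftQ g h ∘ₗ (f.quotKerEquivOfSurjective hf).symm.toLinearMap, ?_⟩
  ext x
  have h1 : (f.quotKerEquivOfSurjective hf).symm (f x) = Submodule.Quotient.mk x := by
    rw [LinearEquiv.symm_apply_eq]; rfl
  simp [h1]

lemma uniserial_of_isSimpleModule {S : Type u} [AddCommGroup S] [Module Λ S]
    [IsSimpleModule Λ S] : Uniserial Λ S := fun N N' => by
  rcases eq_bot_or_eq_top N with rfl | rfl
  · exact Or.inl bot_le
  · exact Or.inr le_top

lemma nonempty_iso_of_simple_quotients {X S T : ModuleCat.{u} Λ} (hX : Uniserial Λ X)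
    (hS : IsSimpleModule Λ S) (hT : IsSimpleModule Λ T) (f : X ⟶ S) (g : X ⟶ T)
    (hf : Function.Surjective f.hom) (hg : Function.Surjective g.hom) : Nonempty (S ≅ T) := by
  wlog h : LinearMap.ker f.hom ≤ LinearMap.ker g.hom generalizing S T
  · exact (this hT hS g f hg hf ((hX _ _).resolve_left h)).map Iso.symm
  obtain ⟨t, ht⟩ := exists_factor_of_ker_le f.hom hf g.hom h
  have ht0 : t ≠ 0 := by
    rintro rfl
    have := IsSimpleModule.nontrivial Λ T
    obtain ⟨y, hy⟩ := exists_ne (0 : T)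
    obtain ⟨x, rfl⟩ := hg y
    exact hy (LinearMap.congr_fun ht x).symm
  exact ⟨(LinearEquiv.ofBijective t (LinearMap.bijective_of_ne_zero ht0)).toModuleIso⟩

lemma isPI_connected
    (hU : ∀ X : ModuleCat.{u} Λ, Module.Finite Λ X → Indec Λ X → Uniserial Λ X)
    (hI : Injective (ModuleCat.of Λ Λ)) [IsArtinianRing Λ]
    (hc : ∀ e : Λ, IsIdempotentElem e → e ∈ Set.center Λ → e = 0 ∨ e = 1)
    (T : ModuleCat.{u} Λ → Prop)
    (hT : ∀ P Q : ModuleCat.{u} Λ, IsPI P → IsPI Q → ∀ f : P ⟶ Q, f ≠ 0 → (T P ↔ T Q)) :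
    (∀ P : ModuleCat.{u} Λ, IsPI P → T P) ∨ ∀ P : ModuleCat.{u} Λ, IsPI P → ¬ T P := by
  let 𝒴 : ModuleCat.{u} Λ → Prop := fun Y => ∀ P : ModuleCat.{u} Λ, IsPI P → T P →
    (∀ f : P ⟶ Y, f = 0) ∧ ∀ f : Y ⟶ P, f = 0
  let 𝒳 : ModuleCat.{u} Λ → Prop := fun X => ∀ Y, 𝒴 Y → (∀ f : X ⟶ Y, f = 0) ∧ ∀ f : Y ⟶ X, f = 0
  have key := fg_induction (Λ := Λ) (fun F => Projective F → Injective F →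
      ∃ (X Y : ModuleCat.{u} Λ) (iX : X ⟶ F) (pX : F ⟶ X) (iY : Y ⟶ F) (pY : F ⟶ Y),
        𝒳 X ∧ 𝒴 Y ∧ pX ≫ iX + pY ≫ iY = 𝟙 F)
    (fun F G e h hp hi => by
      obtain ⟨X, Y, iX, pX, iY, pY, hX, hY, h⟩ := h (Projective.of_iso e.symm hp)
        (Injective.of_iso e.symm hi)
      refine ⟨X, Y, iX ≫ e.hom, e.inv ≫ pX, iY ≫ e.hom, e.inv ≫ pY, hX, hY, ?_⟩
      have := congrArg (fun t => e.inv ≫ t ≫ e.hom) h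
      simpa [Preadditive.add_comp, Preadditive.comp_add] using this)
    (fun F hz hp hi => ⟨F, F, 0, 0, 0, 0, fun Y _ => ⟨fun f => hz.eq_of_src _ _,
      fun f => hz.eq_of_tgt _ _⟩, fun P _ _ => ⟨fun f => hz.eq_of_tgt _ _,
      fun f => hz.eq_of_src _ _⟩, hz.eq_of_src _ _⟩)
    (fun F G hF hG hp hi => by
      have rF : Retract F (F ⊞ G) := ⟨biprod.inl, biprod.fst, by simp⟩
      have rG : Retract G (F ⊞ G) := ⟨biprod.inr, biprod.snd, by simp⟩
      obtain ⟨X, Y, iX, pX, iY, pY, hX, hY, h⟩ := hF rF.projective rF.injective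
      obtain ⟨X', Y', iX', pX', iY', pY', hX', hY', h'⟩ := hG rG.projective rG.injective
      refine ⟨X ⊞ X', Y ⊞ Y', biprod.map iX iX', biprod.map pX pX', biprod.map iY iY',
        biprod.map pY pY', fun Z hZ => ⟨fun f => ?_, fun f => ?_⟩, fun P hP hTP =>
        ⟨fun f => ?_, fun f => ?_⟩, ?_⟩
      · exact biprod.hom_ext' _ _ (((hX Z hZ).1 _).trans comp_zero.symm)
          (((hX' Z hZ).1 _).trans comp_zero.symm)
      · exact biprod.hom_ext _ _ (((hX Z hZ).2 _).trans zero_comp.symm)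
          (((hX' Z hZ).2 _).trans zero_comp.symm)
      · exact biprod.hom_ext _ _ (((hY P hP hTP).1 _).trans zero_comp.symm)
          (((hY' P hP hTP).1 _).trans zero_comp.symm)
      · exact biprod.hom_ext' _ _ (((hY P hP hTP).2 _).trans comp_zero.symm)
          (((hY' P hP hTP).2 _).trans comp_zero.symm)
      · refine biprod.hom_ext' _ _ ?_ ?_
        · have := congrArg (· ≫ (biprod.inl : F ⟶ F ⊞ G)) h
          simpa [Preadditive.comp_add, Preadditive.add_comp] using this
        · have := congrArg (· ≫ (biprod.inr : G ⟶ F ⊞ G)) h'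
          simpa [Preadditive.comp_add, Preadditive.add_comp] using this)
    (fun F hfin hind hp hi => by
      have hF : IsPI F := ⟨hfin, hp, hi, hU F hfin hind, by
        by_contra h
        exact hind.1 (isZero_iff_subsingleton.2 (not_nontrivial_iff_subsingleton.1 h))⟩
      have hz := isZero_zero (ModuleCat.{u} Λ)
      by_cases hTF : T F
      · exact ⟨F, _, 𝟙 F, 𝟙 F, 0, 0, fun Y hY => (hY F hF hTF).imp id id, fun P hP hTP =>
          ⟨fun f => hz.eq_of_tgt _ _, fun f => hz.eq_of_src _ _⟩, by simp⟩
      · refine ⟨_, F, 0, 0, 𝟙 F, 𝟙 F, fun Y hY => ⟨fun f => hz.eq_of_src _ _,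
          fun f => hz.eq_of_tgt _ _⟩, fun P hP hTP => ⟨fun f => ?_, fun f => ?_⟩, by simp⟩
        · by_contra hf
          exact hTF ((hT P F hP hF f hf).1 hTP)
        · by_contra hf
          exact hTF ((hT F P hF hP f hf).2 hTP))
  obtain ⟨X, Y, iX, pX, iY, pY, hX, hY, hXY⟩ := key (ModuleCat.of Λ Λ)
    (inferInstanceAs (Module.Finite Λ Λ))
    (ModuleCat.projective_of_free (Module.Basis.singleton Unit Λ)) hI
  have hcomm (f : ModuleCat.of Λ Λ ⟶ ModuleCat.of Λ Λ) : (pX ≫ iX) ≫ f = f ≫ pX ≫ iX := by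
    have h1 : iX ≫ f ≫ pY = 0 := (hX Y hY).1 _
    have h2 : iY ≫ f ≫ pX = 0 := (hX Y hY).2 _
    calc (pX ≫ iX) ≫ f = (pX ≫ iX) ≫ f ≫ (pX ≫ iX + pY ≫ iY) := by rw [hXY, Category.comp_id]
      _ = pX ≫ (iX ≫ f ≫ pX) ≫ iX + pX ≫ (iX ≫ f ≫ pY) ≫ iY := by
        simp [Preadditive.comp_add]
      _ = pX ≫ (iX ≫ f ≫ pX) ≫ iX + pY ≫ (iY ≫ f ≫ pX) ≫ iX := by simp [h1, h2]
      _ = (pX ≫ iX + pY ≫ iY) ≫ f ≫ pX ≫ iX := by simp [Preadditive.add_comp]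
      _ = f ≫ pX ≫ iX := by rw [hXY, Category.id_comp]
  have hidem : (pX ≫ iX) ≫ pX ≫ iX = pX ≫ iX := by
    have h1 : iX ≫ pY = 0 := (hX Y hY).1 _
    calc (pX ≫ iX) ≫ pX ≫ iX = (pX ≫ iX) ≫ pX ≫ iX + pX ≫ (iX ≫ pY) ≫ iY := by simp [h1]
      _ = (pX ≫ iX) ≫ (pX ≫ iX + pY ≫ iY) := by simp [Preadditive.comp_add]
      _ = pX ≫ iX := by rw [hXY, Category.comp_id]
  generalize hπ : pX ≫ iX = π at hcomm hidem hXY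
  have hπa (a : Λ) : π.hom a = a * π.hom (1 : Λ) := by
    have := π.hom.map_smul a (1 : Λ)
    rwa [smul_eq_mul, mul_one] at this
  have hε : IsIdempotentElem (π.hom (1 : Λ) : Λ) :=
    (hπa _).symm.trans (ConcreteCategory.congr_hom hidem (1 : Λ))
  have hcen : (π.hom (1 : Λ) : Λ) ∈ Set.center Λ := by
    rw [Semigroup.mem_center_iff]
    intro b
    have h1 := ConcreteCategory.congr_hom
      (hcomm (ModuleCat.ofHom (LinearMap.toSpanSingleton Λ Λ b))) (1 : Λ)
    have h2 : π.hom (1 : Λ) * b = π.hom ((1 : Λ) * b) := h1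
    rw [h2, one_mul, hπa b]
  have hne (P : ModuleCat.{u} Λ) (hP : IsPI P) : ∃ g : ModuleCat.of Λ Λ ⟶ P, g ≠ 0 := by
    have := hP.nontriv
    obtain ⟨x, hx⟩ := exists_ne (0 : P)
    refine ⟨ModuleCat.ofHom (LinearMap.toSpanSingleton Λ P x), fun h => hx ?_⟩
    have h1 : (1 : Λ) • x = 0 := ConcreteCategory.congr_hom h (1 : Λ)
    rwa [one_smul] at h1
  rcases hc _ hε hcen with h | h
  · have hπ0 : π = 0 := ModuleCat.hom_ext (LinearMap.ext fun a => by
      change π.hom a = 0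
      rw [hπa, h, mul_zero])
    right
    intro P hP hTP
    obtain ⟨g, hg⟩ := hne P hP
    refine hg ?_
    rw [← Category.id_comp g, ← hXY, hπ0, zero_add, Category.assoc, (hY P hP hTP).2 (iY ≫ g), comp_zero]
  · have hπ1 : π = 𝟙 _ := ModuleCat.hom_ext (LinearMap.ext fun a => by
      change π.hom a = a
      rw [hπa, h, mul_one])
    left
    intro P hP
    by_contra hTP
    obtain ⟨g, hg⟩ := hne P hP
    have hPY : 𝒴 P := fun Q hQ hTQ => ⟨fun f => by
      by_contra hf
      exact hTP ((hT Q P hQ hP f hf).1 hTQ), fun f => by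
      by_contra hf
      exact hTP ((hT P Q hP hQ f hf).2 hTQ)⟩
    refine hg ?_
    rw [← Category.id_comp g, ← hπ1, ← hπ, Category.assoc, (hX P hPY).1 (iX ≫ g), comp_zero]

end Simples

section Cycle

variable {Λ}

lemma Uniserial.le_of_isCoatom {X : Type u} [AddCommGroup X] [Module Λ X] (hX : Uniserial Λ X)
    {K N : Submodule Λ X} (hK : IsCoatom K) (hN : N ≠ ⊤) : N ≤ K := by
  rcases hX N K with h | h
  · exact h
  · exact (hK.le_iff_eq hN).1 h |>.le

variable [IsArtinianRing Λ]

lemma len_add_one_of_isCoatom {X : Type u} [AddCommGroup X] [Module Λ X] [Module.Finite Λ X]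
    {K : Submodule Λ X} (hK : IsCoatom K) : len Λ K + 1 = len Λ X := by
  rw [len_submodule_add_quotient K, len_eq_one_iff.2 (isSimpleModule_iff_isCoatom.2 hK)]

lemma exists_family
    (hU : ∀ X : ModuleCat.{u} Λ, Module.Finite Λ X → Indec Λ X → Uniserial Λ X)
    (hI : Injective (ModuleCat.of Λ Λ)) {n : ℕ}
    (hS : ∃ S : Fin n → ModuleCat.{u} Λ, (∀ i, IsSimpleModule Λ (S i)) ∧
      (∀ i j, Nonempty (S i ≅ S j) → i = j) ∧
      ∀ T : ModuleCat.{u} Λ, IsSimpleModule Λ T → ∃ i, Nonempty (T ≅ S i)) :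
    ∃ P : Fin n → ModuleCat.{u} Λ, (∀ i, IsPI (P i)) ∧ (∀ i j, Nonempty (P i ≅ P j) → i = j) ∧
      ∀ Q : ModuleCat.{u} Λ, IsPI Q → ∃ i, Nonempty (Q ≅ P i) := by
  obtain ⟨S, hS, hSi, hSs⟩ := hS
  have hcov (i : Fin n) : ∃ (P : ModuleCat.{u} Λ) (f : P ⟶ S i), IsPI P ∧ Function.Surjective f.hom := by
    have := hS i
    have := IsSimpleModule.nontrivial Λ (S i)
    exact exists_cover hU hI (S i) uniserial_of_isSimpleModule
  choose P f hP hf using hcov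
  refine ⟨P, hP, ?_, ?_⟩
  · rintro i j ⟨e⟩
    exact hSi i j (nonempty_iso_of_simple_quotients (hP i).uni (hS i) (hS j) (f i) (e.hom ≫ f j)
      (hf i) ((hf j).comp e.toLinearEquiv.surjective))
  · intro Q hQ
    have := hQ.fin
    have := hQ.nontriv
    obtain ⟨K, hK⟩ := IsCoatomic.exists_coatom (Submodule Λ Q)
    obtain ⟨i, ⟨e⟩⟩ := hSs (ModuleCat.of Λ (Q ⧸ K)) (isSimpleModule_iff_isCoatom.2 hK)
    let g : Q ⟶ S i := ModuleCat.ofHom K.mkQ ≫ e.hom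
    have hg : Function.Surjective g.hom := e.toLinearEquiv.surjective.comp K.mkQ_surjective
    refine ⟨i, hQ.iso_of_range_eq (hP i) g (f i) (fun h0 => ?_) ?_⟩
    · have := hS i
      have := IsSimpleModule.nontrivial Λ (S i)
      obtain ⟨y, hy⟩ := exists_ne (0 : S i)
      obtain ⟨x, rfl⟩ := hg y
      rw [h0] at hy
      exact hy rfl
    · rw [LinearMap.range_eq_top.2 hg, LinearMap.range_eq_top.2 (hf i)]

omit [IsArtinianRing Λ] in
lemma IsPI.not_injective_of_isCoatom {P Q : ModuleCat.{u} Λ} (hP : IsPI P) (hQ : IsPI Q)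
    (f : P ⟶ Q) (hf : IsCoatom (LinearMap.range f.hom)) : ¬ Function.Injective f.hom := fun h =>
  hf.1 (LinearMap.range_eq_top.2 (hP.surjective_of_injective hQ.uni f h))

lemma IsPI.eq_of_common_radical {P Q R : ModuleCat.{u} Λ} (hP : IsPI P) (hQ : IsPI Q)
    (f : R ⟶ P) (g : R ⟶ Q) (hf : IsCoatom (LinearMap.range f.hom))
    (hg : IsCoatom (LinearMap.range g.hom)) (hf0 : f ≠ 0)
    (h : LinearMap.ker g.hom ≤ LinearMap.ker f.hom) : Nonempty (Q ≅ P) := by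
  obtain ⟨t, ht⟩ := exists_factor_of_ker_le g.hom.rangeRestrict g.hom.surjective_rangeRestrict
    f.hom (by rwa [LinearMap.ker_rangeRestrict])
  have := hP.inj
  let ι : ModuleCat.of Λ (LinearMap.range g.hom) ⟶ Q := ModuleCat.ofHom (Submodule.subtype _)
  have : Mono ι := (ModuleCat.mono_iff_injective _).2 (Submodule.injective_subtype _)
  let s : Q ⟶ P := Injective.factorThru (ModuleCat.ofHom t) ι
  have hs : ι ≫ s = ModuleCat.ofHom t := Injective.comp_factorThru _ _
  have hgs : g ≫ s = f := ModuleCat.hom_ext (LinearMap.ext fun x =>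
    (ConcreteCategory.congr_hom hs (g.hom.rangeRestrict x)).trans (LinearMap.congr_fun ht x))
  have hs0 : s ≠ 0 := by
    rintro h0
    rw [h0, comp_zero] at hgs
    exact hf0 hgs.symm
  by_cases hsurj : Function.Surjective s.hom
  · refine hQ.iso_of_range_eq hP s (𝟙 P) hs0 ?_
    rw [LinearMap.range_eq_top.2 hsurj, ModuleCat.hom_id, LinearMap.range_id]
  · have h1 : LinearMap.range s.hom = LinearMap.range f.hom := by
      refine le_antisymm (hP.uni.le_of_isCoatom hf fun h => hsurj (LinearMap.range_eq_top.1 h)) ?_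
      rw [← hgs]
      exact LinearMap.range_comp_le_range g.hom s.hom
    refine absurd (hQ.uni.eq_top_of_map_eq_range s.hom
      (fun h0 => hs0 (ModuleCat.hom_ext h0)) (N := LinearMap.range g.hom) ?_) hg.1
    rw [h1, ← hgs, ← LinearMap.range_comp]
    rfl

end Cycle

section CyclicFamily

variable {Λ}

variable [IsArtinianRing Λ]

/-- The indecomposable projectives arranged in a cycle of period `n`, each one covering the
radical of its predecessor. -/
structure CyclicFamily (n L : ℕ) (P : ℤ → ModuleCat.{u} Λ) : Prop where
  isPI : ∀ a, IsPI (P a)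
  len_eq : ∀ a, len Λ (P a) = L
  exists_rad : ∀ a, ∃ ρ : P (a + 1) ⟶ P a, IsCoatom (LinearMap.range ρ.hom)
  exists_iso : ∀ Q : ModuleCat.{u} Λ, IsPI Q → ∃ a, Nonempty (Q ≅ P a)
  nonempty_iso_iff : ∀ a b, Nonempty (P a ≅ P b) ↔ a ≡ b [ZMOD n]

omit [IsArtinianRing Λ] in
lemma ne_zero_of_isCoatom_range {P Q : ModuleCat.{u} Λ} (hQ : ¬ IsSimpleModule Λ Q) (f : P ⟶ Q)
    (hf : IsCoatom (LinearMap.range f.hom)) : f ≠ 0 := by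
  rintro rfl
  rw [show LinearMap.range (ModuleCat.Hom.hom (0 : P ⟶ Q)) = ⊥ from LinearMap.range_zero] at hf
  exact hQ ((isSimpleModule_iff Λ Q).2 (isSimpleOrder_iff_isCoatom_bot.2 hf))

lemma not_isSimpleModule_of_family
    (hU : ∀ X : ModuleCat.{u} Λ, Module.Finite Λ X → Indec Λ X → Uniserial Λ X)
    (hI : Injective (ModuleCat.of Λ Λ))
    (hc : ∀ e : Λ, IsIdempotentElem e → e ∈ Set.center Λ → e = 0 ∨ e = 1)
    {n : ℕ} (hn : 2 ≤ n) (P : Fin n → ModuleCat.{u} Λ) (hP : ∀ i, IsPI (P i))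
    (hPi : ∀ i j, Nonempty (P i ≅ P j) → i = j) (i : Fin n) : ¬ IsSimpleModule Λ (P i) := by
  intro hs
  have hT (Q R : ModuleCat.{u} Λ) (hQ : IsPI Q) (hR : IsPI R) (f : Q ⟶ R) (hf : f ≠ 0) :
      Nonempty (Q ≅ P i) ↔ Nonempty (R ≅ P i) := by
    have hf0 : f.hom ≠ 0 := fun h0 => hf (ModuleCat.hom_ext h0)
    have key : Function.Surjective f.hom → Nonempty (Q ≅ R) := fun h =>
      hQ.iso_of_range_eq hR f (𝟙 R) hf (by
        rw [LinearMap.range_eq_top.2 h, ModuleCat.hom_id, LinearMap.range_id])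
    constructor
    · rintro ⟨e⟩
      have := IsSimpleModule.congr e.toLinearEquiv
      obtain ⟨e'⟩ := key (hQ.surjective_of_injective hR.uni f
        ((LinearMap.injective_or_eq_zero f.hom).resolve_right hf0))
      exact ⟨e'.symm ≪≫ e⟩
    · rintro ⟨e⟩
      have := IsSimpleModule.congr e.toLinearEquiv
      obtain ⟨e'⟩ := key ((LinearMap.surjective_or_eq_zero f.hom).resolve_right hf0)
      exact ⟨e' ≪≫ e⟩
  rcases isPI_connected hU hI hc (fun Q => Nonempty (Q ≅ P i)) hT with h | h
  · have : Nontrivial (Fin n) := Fin.nontrivial_iff_two_le.2 hn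
    obtain ⟨j, hj⟩ := exists_ne i
    exact hj (hPi _ _ (h (P j) (hP j)))
  · exact h (P i) (hP i) ⟨Iso.refl _⟩

lemma exists_isPI_isCoatom_range
    (hU : ∀ X : ModuleCat.{u} Λ, Module.Finite Λ X → Indec Λ X → Uniserial Λ X)
    (hI : Injective (ModuleCat.of Λ Λ)) {P : ModuleCat.{u} Λ} (hP : IsPI P)
    (hs : ¬ IsSimpleModule Λ P) :
    ∃ (Q : ModuleCat.{u} Λ) (f : Q ⟶ P), IsPI Q ∧ IsCoatom (LinearMap.range f.hom) := by
  have := hP.fin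
  have := hP.nontriv
  obtain ⟨K, hK⟩ := IsCoatomic.exists_coatom (Submodule Λ P)
  have hK0 : K ≠ ⊥ := by
    rintro rfl
    exact hs ((isSimpleModule_iff Λ P).2 (isSimpleOrder_iff_isCoatom_bot.2 hK))
  have : Nontrivial K := Submodule.nontrivial_iff_ne_bot.2 hK0
  obtain ⟨Q, f, hQ, hf⟩ := exists_cover hU hI (ModuleCat.of Λ K)
    (hP.uni.of_injective K.subtype K.injective_subtype)
  refine ⟨Q, f ≫ ModuleCat.ofHom K.subtype, hQ, ?_⟩
  rw [ModuleCat.hom_comp, LinearMap.range_comp, LinearMap.range_eq_top.2 hf]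
  simpa using hK

lemma exists_perm_iterate {n : ℕ} (P : Fin n → ModuleCat.{u} Λ) (hP : ∀ i, IsPI (P i))
    (hPi : ∀ i j, Nonempty (P i ≅ P j) → i = j) (σ : Equiv.Perm (Fin n))
    (hσ : ∀ i, ∃ ρ : P (σ i) ⟶ P i, IsCoatom (LinearMap.range ρ.hom))
    {i j : Fin n} (f : P i ⟶ P j) (hf : f ≠ 0) : ∃ k : ℕ, i = (σ ^ k) j := by
  have := (hP i).fin
  induction h : len Λ (LinearMap.ker f.hom) using Nat.strong_induction_on generalizing j with
  | _ d ih =>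
    by_cases hs : Function.Surjective f.hom
    · refine ⟨0, hPi i j ((hP i).iso_of_range_eq (hP j) f (𝟙 (P j)) hf ?_)⟩
      rw [LinearMap.range_eq_top.2 hs, ModuleCat.hom_id, LinearMap.range_id]
    · obtain ⟨ρ, hρ⟩ := hσ j
      have := (hP i).proj
      obtain ⟨t, ht⟩ := exists_lift_of_range_le f ρ
        ((hP j).uni.le_of_isCoatom hρ fun h => hs (LinearMap.range_eq_top.1 h))
      have hle : LinearMap.ker t.hom ≤ LinearMap.ker f.hom := by
        rw [← ht]; exact LinearMap.ker_le_ker_comp _ _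
      have ht0 : t ≠ 0 := by
        rintro rfl
        exact hf (by rw [← ht, zero_comp])
      have hlt : len Λ (LinearMap.ker t.hom) < d := by
        rw [← h]
        refine lt_of_not_ge fun hge => ?_
        have heq := eq_of_le_of_len hle hge
        have hft (x) : f.hom x = ρ.hom (t.hom x) := by rw [← ht]; rfl
        rcases (hP (σ j)).uni (LinearMap.range t.hom) (LinearMap.ker ρ.hom) with h1 | h1
        · exact hf (ModuleCat.hom_ext (LinearMap.ext fun x =>
            (hft x).trans (h1 ⟨x, rfl⟩)))
        · refine (hP (σ j)).not_injective_of_isCoatom (hP j) ρ hρ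
            (LinearMap.ker_eq_bot.1 ((Submodule.eq_bot_iff _).2 fun y hy => ?_))
          obtain ⟨x, rfl⟩ := h1 hy
          have hx : x ∈ LinearMap.ker f.hom := (hft x).trans hy
          rw [← heq] at hx
          exact hx
      obtain ⟨k, hk⟩ := ih _ hlt t ht0 rfl
      exact ⟨k + 1, by rw [hk, pow_succ]; rfl⟩

lemma exists_cyclicFamily
    (hU : ∀ X : ModuleCat.{u} Λ, Module.Finite Λ X → Indec Λ X → Uniserial Λ X)
    (hI : Injective (ModuleCat.of Λ Λ))
    (hc : ∀ e : Λ, IsIdempotentElem e → e ∈ Set.center Λ → e = 0 ∨ e = 1)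
    {n : ℕ} (hn : 2 ≤ n)
    (hS : ∃ S : Fin n → ModuleCat.{u} Λ, (∀ i, IsSimpleModule Λ (S i)) ∧
      (∀ i j, Nonempty (S i ≅ S j) → i = j) ∧
      ∀ T : ModuleCat.{u} Λ, IsSimpleModule Λ T → ∃ i, Nonempty (T ≅ S i)) :
    ∃ (L : ℕ) (P : ℤ → ModuleCat.{u} Λ), CyclicFamily n L P := by
  obtain ⟨P, hP, hPi, hPs⟩ := exists_family hU hI hS
  have hns := not_isSimpleModule_of_family hU hI hc hn P hP hPi
  have hex (i) : ∃ j, ∃ ρ : P j ⟶ P i, IsCoatom (LinearMap.range ρ.hom) := by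
    obtain ⟨Q, f, hQ, hf⟩ := exists_isPI_isCoatom_range hU hI (hP i) (hns i)
    obtain ⟨j, ⟨e⟩⟩ := hPs Q hQ
    refine ⟨j, e.inv ≫ f, ?_⟩
    have h1 : LinearMap.range e.inv.hom = ⊤ :=
      LinearMap.range_eq_top.2 e.symm.toLinearEquiv.surjective
    rw [ModuleCat.hom_comp, LinearMap.range_comp, h1]
    simpa using hf
  choose σ' hσ' using hex
  have hinj : Function.Injective σ' := by
    intro i j hij
    obtain ⟨f, hf⟩ := hσ' i
    obtain ⟨g, hg⟩ : ∃ ρ : P (σ' i) ⟶ P j, IsCoatom (LinearMap.range ρ.hom) := by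
      rw [hij]; exact hσ' j
    rcases (hP (σ' i)).uni (LinearMap.ker f.hom) (LinearMap.ker g.hom) with h | h
    · exact hPi _ _ ((hP j).eq_of_common_radical (hP i) g f hg hf
        (ne_zero_of_isCoatom_range (hns j) g hg) h)
    · exact (hPi _ _ ((hP i).eq_of_common_radical (hP j) f g hf hg
        (ne_zero_of_isCoatom_range (hns i) f hf) h)).symm
  let σ : Equiv.Perm (Fin n) := Equiv.ofBijective σ' (Finite.injective_iff_bijective.1 hinj)
  have hσ : ∀ i, ∃ ρ : P (σ i) ⟶ P i, IsCoatom (LinearMap.range ρ.hom) := hσ'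
  have hle (i) : len Λ (P i) ≤ len Λ (P (σ i)) := by
    obtain ⟨ρ, hρ⟩ := hσ i
    have := (hP i).fin
    have := (hP (σ i)).fin
    have h1 := len_add_one_of_isCoatom hρ
    have h2 := len_ker_add_range ρ.hom
    have h3 : len Λ (LinearMap.ker ρ.hom) ≠ 0 := fun h =>
      (hP (σ i)).not_injective_of_isCoatom (hP i) ρ hρ
        (LinearMap.ker_eq_bot.1 ((Submodule.subsingleton_iff_eq_bot).1 (len_eq_zero_iff.1 h)))
    lia
  have heq (i) : len Λ (P (σ i)) = len Λ (P i) :=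
    ((Finset.sum_eq_sum_iff_of_le (s := Finset.univ) fun i _ => hle i).1
      (Equiv.sum_comp σ fun i => len Λ (P i)).symm i (Finset.mem_univ i)).symm
  let o : Fin n := ⟨0, by lia⟩
  have hcyc (i) : ∃ z : ℤ, (σ ^ z) o = i := by
    have hsame {Q R : ModuleCat.{u} Λ} (hQ : IsPI Q) (hR : IsPI R) (f : Q ⟶ R) (hf : f ≠ 0) :
        ∃ i j, Nonempty (Q ≅ P i) ∧ Nonempty (R ≅ P j) ∧ ∃ k : ℕ, i = (σ ^ k) j := by
      obtain ⟨i, ⟨e⟩⟩ := hPs Q hQ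
      obtain ⟨j, ⟨e'⟩⟩ := hPs R hR
      refine ⟨i, j, ⟨e⟩, ⟨e'⟩, exists_perm_iterate P hP hPi σ hσ (e.inv ≫ f ≫ e'.hom) ?_⟩
      intro h
      refine hf ?_
      rw [← cancel_mono e'.hom, ← cancel_epi e.inv, h, zero_comp, comp_zero]
    have hT (Q R : ModuleCat.{u} Λ) (hQ : IsPI Q) (hR : IsPI R) (f : Q ⟶ R) (hf : f ≠ 0) :
        (∃ z : ℤ, Nonempty (Q ≅ P ((σ ^ z) o))) ↔ ∃ z : ℤ, Nonempty (R ≅ P ((σ ^ z) o)) := by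
      obtain ⟨i, j, ⟨e⟩, ⟨e'⟩, k, hk⟩ := hsame hQ hR f hf
      constructor
      · rintro ⟨z, ⟨e₁⟩⟩
        have h1 : i = (σ ^ z) o := hPi _ _ ⟨e.symm ≪≫ e₁⟩
        refine ⟨-k + z, ⟨e' ≪≫ eqToIso ?_⟩⟩
        rw [zpow_add, Equiv.Perm.mul_apply, ← h1, hk, zpow_neg, zpow_natCast]
        simp
      · rintro ⟨z, ⟨e₁⟩⟩
        have h1 : j = (σ ^ z) o := hPi _ _ ⟨e'.symm ≪≫ e₁⟩
        refine ⟨k + z, ⟨e ≪≫ eqToIso ?_⟩⟩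
        rw [zpow_add, Equiv.Perm.mul_apply, ← h1, hk, zpow_natCast]
    rcases isPI_connected hU hI hc (fun Q => ∃ z : ℤ, Nonempty (Q ≅ P ((σ ^ z) o))) hT with h | h
    · obtain ⟨z, hz⟩ := h (P i) (hP i)
      exact ⟨z, (hPi _ _ hz).symm⟩
    · exact absurd ⟨0, ⟨Iso.refl _⟩⟩ (h (P o) (hP o))
  have hon : σ.IsCycleOn (Finset.univ : Finset (Fin n)) := by
    refine ⟨by simp, fun x _ y _ => ?_⟩
    obtain ⟨z, rfl⟩ := hcyc x
    obtain ⟨w, rfl⟩ := hcyc y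
    exact ⟨w - z, by rw [← Equiv.Perm.mul_apply, ← zpow_add, sub_add_cancel]⟩
  have hsucc (a : ℤ) : (σ ^ (a + 1)) o = σ ((σ ^ a) o) := by
    rw [add_comm, zpow_one_add, Equiv.Perm.mul_apply]
  refine ⟨len Λ (P o), fun a => P ((σ ^ a) o), fun a => hP _, fun a => ?_, fun a => ?_,
    fun Q hQ => ?_, fun a b => ?_⟩
  · induction a using Int.induction_on with
    | zero => rfl
    | succ a ih => rw [hsucc, heq, ih]
    | pred a ih =>
      rw [← ih, ← heq, ← hsucc, sub_add_cancel]
  · rw [hsucc]; exact hσ _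
  · obtain ⟨i, hi⟩ := hPs Q hQ
    obtain ⟨z, rfl⟩ := hcyc i
    exact ⟨z, hi⟩
  · have h1 := hon.zpow_apply_eq_zpow_apply (Finset.mem_univ o) (m := a) (n := b)
    rw [Finset.card_univ, Fintype.card_fin] at h1
    rw [← h1]
    exact ⟨hPi _ _, fun h => ⟨eqToIso (by rw [h])⟩⟩

end CyclicFamily

section Loewy

variable {Λ}

variable {X : Type u} [AddCommGroup X] [Module Λ X]

lemma radPow_eq_bot_of_le {r s : ℕ} (h : r ≤ s) (hr : radPow Λ r = ⊥) : radPow Λ s = ⊥ := by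
  induction h with
  | refl => exact hr
  | step _ ih =>
    refine (Submodule.span_eq_bot).2 ?_
    rintro x ⟨a, -, b, hb, rfl⟩
    rw [ih, Submodule.mem_bot] at hb
    rw [hb, mul_zero]

lemma smul_mem_of_isCoatom {K : Submodule Λ X} (hK : IsCoatom K) {a : Λ}
    (ha : a ∈ Ideal.jacobson (⊥ : Ideal Λ)) (x : X) : a • x ∈ K := by
  rw [Ideal.jacobson_bot] at ha
  exact sInf_le (show K ∈ {m : Submodule Λ X | IsCoatom m} from hK)
    (Ring.jacobson_smul_top_le Λ X (Submodule.smul_mem_smul ha Submodule.mem_top))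

variable [IsArtinianRing Λ] [Module.Finite Λ X]

lemma exists_radPow_smul_mem (r : ℕ) : ∃ N : Submodule Λ X, len Λ N ≤ len Λ X - r ∧
    ∀ x ∈ radPow Λ r, ∀ y : X, x • y ∈ N := by
  induction r with
  | zero => exact ⟨⊤, by rw [len_top, Nat.sub_zero], fun _ _ _ => Submodule.mem_top⟩
  | succ r ih =>
    obtain ⟨N, hN, h⟩ := ih
    obtain ⟨N', hN', h'⟩ : ∃ N' : Submodule Λ X, len Λ N' ≤ len Λ N - 1 ∧
        ∀ a ∈ Ideal.jacobson (⊥ : Ideal Λ), ∀ y ∈ N, a • y ∈ N' := by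
      rcases subsingleton_or_nontrivial N with h0 | h0
      · exact ⟨N, (len_eq_zero_iff.2 h0).le.trans (Nat.zero_le _), fun a _ y hy => N.smul_mem a hy⟩
      · obtain ⟨K, hK⟩ := IsCoatomic.exists_coatom (Submodule Λ N)
        refine ⟨K.map N.subtype, ?_, fun a ha y hy => ⟨a • ⟨y, hy⟩, ?_, rfl⟩⟩
        · have := len_add_one_of_isCoatom hK
          have := len_map_le N.subtype K
          lia
        · exact smul_mem_of_isCoatom hK ha _
    refine ⟨N', by lia, fun x hx y => ?_⟩
    induction hx using Submodule.span_induction with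
    | mem x hx =>
      obtain ⟨a, ha, b, hb, rfl⟩ := hx
      rw [mul_smul]
      exact h' a ha _ (h b hb y)
    | zero => simp
    | add x z _ _ hx hz => rw [add_smul]; exact N'.add_mem hx hz
    | smul c x _ hx => rw [smul_assoc]; exact N'.smul_mem c hx

lemma len_le_add_one_of_smul_mem (hX : Uniserial Λ X) (D : Submodule Λ X)
    (h : ∀ a ∈ Ideal.jacobson (⊥ : Ideal Λ), ∀ z : X, a • z ∈ D) : len Λ X ≤ len Λ D + 1 := by
  rw [len_submodule_add_quotient D, add_le_add_iff_left]
  rcases subsingleton_or_nontrivial (X ⧸ D) with h0 | h0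
  · rw [len_eq_zero_iff.2 h0]; simp
  have hQ : Uniserial Λ (X ⧸ D) := hX.of_surjective D.mkQ D.mkQ_surjective
  obtain ⟨K, hK⟩ := IsCoatomic.exists_coatom (Submodule Λ (X ⧸ D))
  obtain ⟨q, hq⟩ := SetLike.exists_not_mem_of_ne_top K hK.1
  have hgen : LinearMap.range (LinearMap.toSpanSingleton Λ (X ⧸ D) q) = ⊤ := by
    by_contra hne
    exact hq (hQ.le_of_isCoatom hK hne ⟨1, by simp⟩)
  have hss : IsSemisimpleModule Λ (Λ ⧸ Module.jacobson Λ Λ) :=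
    (IsArtinian.isSemisimpleModule_iff_jacobson _ _).2 (Module.jacobson_quotient_jacobson Λ Λ)
  obtain ⟨x, rfl⟩ := D.mkQ_surjective q
  let f : (Λ ⧸ Module.jacobson Λ Λ) →ₗ[Λ] X ⧸ D :=
    (Module.jacobson Λ Λ).liftQ (LinearMap.toSpanSingleton Λ (X ⧸ D) (D.mkQ x)) fun a ha => by
      refine (Submodule.Quotient.mk_eq_zero D (x := a • x)).2 (h a ?_ x)
      rw [Ideal.jacobson_bot]
      exact ha
  have hf : Function.Surjective f := by
    rw [← LinearMap.range_eq_top, ← hgen]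
    exact Submodule.range_liftQ _ _ _
  have hs : IsSemisimpleModule Λ (X ⧸ D) := IsSemisimpleModule.of_surjective f hf
  refine (len_eq_one_iff.2 ((isSimpleModule_iff Λ _).2 ⟨fun N => ?_⟩)).le
  obtain ⟨N', hN'⟩ := exists_isCompl N
  rcases hQ N N' with h1 | h1
  · exact Or.inl (by rw [← inf_eq_left.2 h1, hN'.inf_eq_bot])
  · exact Or.inr (by rw [← sup_eq_left.2 h1, hN'.sup_eq_top])

lemma len_le_add_of_radPow_smul_mem (hX : Uniserial Λ X) (r : ℕ) (D : Submodule Λ X)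
    (h : ∀ x ∈ radPow Λ r, ∀ y : X, x • y ∈ D) : len Λ X ≤ len Λ D + r := by
  induction r generalizing D with
  | zero =>
    have : D = ⊤ := eq_top_iff.2 fun y _ => by simpa using h 1 Submodule.mem_top y
    rw [this, len_top, add_zero]
  | succ r ih =>
    let E : Submodule Λ X := Submodule.span Λ {z | ∃ b ∈ radPow Λ r, ∃ y : X, z = b • y}
    have h1 := ih E fun x hx y => Submodule.subset_span ⟨x, hx, y, rfl⟩
    have h2 (e : X) (he : e ∈ E) : ∀ a ∈ Ideal.jacobson (⊥ : Ideal Λ), a • e ∈ D := by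
      induction he using Submodule.span_induction with
      | mem e he =>
        obtain ⟨b, hb, y, rfl⟩ := he
        intro a ha
        rw [← mul_smul]
        exact h _ (Submodule.subset_span ⟨a, ha, b, hb, rfl⟩) y
      | zero => simp
      | add x z _ _ hx hz =>
        intro a ha
        rw [smul_add]
        exact D.add_mem (hx a ha) (hz a ha)
      | smul c x _ hx =>
        intro a ha
        rw [← mul_smul]
        refine hx _ ?_
        rw [Ideal.jacobson_bot] at ha ⊢
        exact Ideal.mul_mem_right _ _ ha
    have h3 := len_le_add_one_of_smul_mem (hX.of_injective E.subtype E.injective_subtype)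
      (D.comap E.subtype) fun a ha z => h2 z z.2 a ha
    have h4 : len Λ (D.comap E.subtype) ≤ len Λ D :=
      len_le_of_injective (E.subtype.restrict (p := D.comap E.subtype) (q := D) fun _ hx => hx)
        fun x y hxy => Subtype.ext (Subtype.ext (congrArg (fun z : D => (z : X)) hxy))
    lia

lemma CyclicFamily.loewy_eq {n L m : ℕ} {P : ℤ → ModuleCat.{u} Λ} (hP : CyclicFamily n L P)
    (hU : ∀ X : ModuleCat.{u} Λ, Module.Finite Λ X → Indec Λ X → Uniserial Λ X)
    (hI : Injective (ModuleCat.of Λ Λ)) (hm : 0 < m) (htop : radPow Λ m = ⊥)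
    (hbot : radPow Λ (m - 1) ≠ ⊥) : L = m := by
  refine le_antisymm ?_ ?_
  · have := (hP.isPI 0).fin
    have h := len_le_add_of_radPow_smul_mem (hP.isPI 0).uni m ⊥ fun x hx y => by
      rw [htop, Submodule.mem_bot] at hx
      simp [hx]
    rw [hP.len_eq, len_eq_zero_iff.2 inferInstance] at h
    lia
  · by_contra hlt
    refine hbot (radPow_eq_bot_of_le (r := L) (by lia) ((Submodule.eq_bot_iff _).2 fun x hx => ?_))
    have key := fg_induction (Λ := Λ) (fun X => ∀ y : X, x • y = 0)
      (fun X Y e h y => by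
        rw [← e.toLinearEquiv.apply_symm_apply y, ← map_smul, h, map_zero])
      (fun X hX y => by
        have := isZero_iff_subsingleton.1 hX
        exact Subsingleton.elim _ _)
      (fun X Y hX hY y => by
        refine (ModuleCat.biprodIsoProd X Y).toLinearEquiv.injective ?_
        rw [map_smul, map_zero]
        exact Prod.ext (hX _) (hY _))
      (fun X hX hXi y => by
        have : Nontrivial X := not_subsingleton_iff_nontrivial.1 fun h =>
          hXi.1 (isZero_iff_subsingleton.2 h)
        obtain ⟨Q, f, hQ, hf⟩ := exists_cover hU hI X (hU X hX hXi)
        obtain ⟨a, ⟨e⟩⟩ := hP.exists_iso Q hQ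
        have := hQ.fin
        have h1 := len_le_of_surjective f.hom hf
        rw [len_congr Λ e.toLinearEquiv, hP.len_eq] at h1
        obtain ⟨N, hN, h⟩ := exists_radPow_smul_mem (Λ := Λ) (X := X) L
        have h2 : len Λ N = 0 := by lia
        have hN0 : N = ⊥ := (Submodule.subsingleton_iff_eq_bot).1 (len_eq_zero_iff.1 h2)
        have := h x hx y
        rwa [hN0, Submodule.mem_bot] at this)
      (ModuleCat.of Λ Λ) (inferInstanceAs (Module.Finite Λ Λ))
    simpa using key (1 : Λ)

end Loewy

section Interval

variable {Λ}

/-- `X` is a quotient of `P a` of length `b - a`. -/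
def IsInt (P : ℤ → ModuleCat.{u} Λ) (X : ModuleCat.{u} Λ) (a b : ℤ) : Prop :=
  (∃ f : P a ⟶ X, Function.Surjective f.hom) ∧ (len Λ X : ℤ) = b - a

variable [IsArtinianRing Λ]

/-- A map out of a quotient of a uniserial projective lifts along a map from a module that is not
longer, as soon as the ranges allow it. -/
lemma exists_lift_of_len_le {P N W Y : ModuleCat.{u} Λ} (hP : IsPI P) [Module.Finite Λ W]
    (p : P ⟶ N) (hp : Function.Surjective p.hom) (h : N ⟶ Y) (g : W ⟶ Y)
    (hr : LinearMap.range h.hom ≤ LinearMap.range g.hom) (hl : len Λ W ≤ len Λ N) :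
    ∃ s : N ⟶ W, s ≫ g = h := by
  have := hP.proj
  have := hP.fin
  obtain ⟨t, ht⟩ := exists_lift_of_range_le (p ≫ h) g
    ((LinearMap.range_comp_le_range p.hom h.hom).trans hr)
  have hk : LinearMap.ker p.hom ≤ LinearMap.ker t.hom := by
    refine hP.uni.le_of_len ?_
    have h1 := len_ker_add_range p.hom
    have h2 := len_ker_add_range t.hom
    have h3 := len_submodule_le (LinearMap.range t.hom)
    rw [len_range_of_surjective p.hom hp] at h1
    lia
  obtain ⟨s, hs⟩ := exists_factor_of_ker_le p.hom hp t.hom hk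
  have : Epi p := (ModuleCat.epi_iff_surjective p).2 hp
  have hps : p ≫ ModuleCat.ofHom s = t := ModuleCat.hom_ext hs
  exact ⟨ModuleCat.ofHom s, by rw [← cancel_epi p, reassoc_of% hps, ht]⟩

/-- A map from a uniserial module factors through a quotient that is at least as long as the
range. -/
lemma exists_factor_of_len_le {C S D : ModuleCat.{u} Λ} (hC : Uniserial Λ C) [Module.Finite Λ C]
    (q : C ⟶ S) (hq : Function.Surjective q.hom) (r : C ⟶ D)
    (hl : len Λ (LinearMap.range r.hom) ≤ len Λ S) : ∃ s : S ⟶ D, q ≫ s = r := by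
  have hk : LinearMap.ker q.hom ≤ LinearMap.ker r.hom := by
    refine hC.le_of_len ?_
    have h1 := len_ker_add_range q.hom
    have h2 := len_ker_add_range r.hom
    rw [len_range_of_surjective q.hom hq] at h1
    lia
  obtain ⟨s, hs⟩ := exists_factor_of_ker_le q.hom hq r.hom hk
  exact ⟨ModuleCat.ofHom s, ModuleCat.hom_ext hs⟩

lemma len_map_of_isCoatom {P Y : ModuleCat.{u} Λ} [Module.Finite Λ P] (hP : Uniserial Λ P)
    {K : Submodule Λ P} (hK : IsCoatom K) (f : P ⟶ Y) (hf : f ≠ 0) :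
    len Λ (K.map f.hom) + 1 = len Λ (LinearMap.range f.hom) := by
  have h1 := len_add_one_of_isCoatom hK
  have h2 := len_ker_add_range f.hom
  have h3 := len_ker_add_range (f.hom ∘ₗ K.subtype)
  rw [LinearMap.range_comp, Submodule.range_subtype] at h3
  have h4 : LinearMap.ker f.hom ≤ K :=
    hP.le_of_isCoatom hK fun h => hf (ModuleCat.hom_ext (LinearMap.ker_eq_top.1 h))
  have h5 : len Λ (LinearMap.ker (f.hom ∘ₗ K.subtype)) = len Λ (LinearMap.ker f.hom) := by
    rw [LinearMap.ker_comp]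
    exact len_congr Λ (Submodule.submoduleOfEquivOfLe h4)
  lia

section

variable {P : ℤ → ModuleCat.{u} Λ} {n m : ℕ} (hP : CyclicFamily n m P) {X Y : ModuleCat.{u} Λ}
  {a b a' b' : ℤ}

include hP

omit [IsArtinianRing Λ] in
lemma IsInt.finite (h : IsInt P X a b) : Module.Finite Λ X := by
  obtain ⟨⟨f, hf⟩, -⟩ := h
  have := (hP.isPI a).fin
  exact Module.Finite.of_surjective f.hom hf

omit [IsArtinianRing Λ] in
lemma IsInt.uniserial (h : IsInt P X a b) : Uniserial Λ X := by
  obtain ⟨⟨f, hf⟩, -⟩ := h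
  exact (hP.isPI a).uni.of_surjective f.hom hf

lemma IsInt.sub_le (h : IsInt P X a b) : b - a ≤ m := by
  have := (hP.isPI a).fin
  have := h.finite hP
  obtain ⟨⟨f, hf⟩, h⟩ := h
  have := len_le_of_surjective f.hom hf
  rw [hP.len_eq] at this
  lia

omit [IsArtinianRing Λ] in
lemma IsInt.shift (h : IsInt P X a b) (haa : a ≡ a' [ZMOD n]) (hb : b' - a' = b - a) :
    IsInt P X a' b' := by
  obtain ⟨⟨f, hf⟩, h⟩ := h
  obtain ⟨e⟩ := (hP.nonempty_iso_iff a' a).2 haa.symm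
  exact ⟨⟨e.hom ≫ f, hf.comp e.toLinearEquiv.surjective⟩, by rw [h, hb]⟩

lemma IsInt.exists_surjective (hX : IsInt P X a b) (hY : IsInt P Y a b') (h : b' ≤ b) :
    ∃ f : X ⟶ Y, Function.Surjective f.hom := by
  have := (hP.isPI a).fin
  obtain ⟨⟨f, hf⟩, hX⟩ := hX
  obtain ⟨⟨g, hg⟩, hY⟩ := hY
  obtain ⟨s, hs⟩ := exists_factor_of_len_le (hP.isPI a).uni f hf g
    (by rw [len_range_of_surjective g.hom hg]; lia)
  refine ⟨s, Function.Surjective.of_comp (g := f.hom) ?_⟩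
  rw [← hs] at hg
  exact hg

lemma IsInt.nonempty_iso (hX : IsInt P X a b) (hY : IsInt P Y a b) : Nonempty (X ≅ Y) := by
  have := hX.finite hP
  obtain ⟨f, hf⟩ := hX.exists_surjective hP hY le_rfl
  have h1 := hX.2
  have h2 := hY.2
  exact ⟨(LinearEquiv.ofBijective f.hom
    ⟨injective_of_surjective_of_len f.hom hf (by lia), hf⟩).toModuleIso⟩

lemma CyclicFamily.exists_range_len (f : P a ⟶ X) (k : ℕ) :
    ∃ g : P (a + k) ⟶ X, len Λ (LinearMap.range g.hom) = len Λ (LinearMap.range f.hom) - k ∧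
      LinearMap.range g.hom ≤ LinearMap.range f.hom := by
  induction k with
  | zero =>
    rw [show a + ((0 : ℕ) : ℤ) = a by simp]
    exact ⟨f, by simp, le_rfl⟩
  | succ k ih =>
    obtain ⟨g, hg, hgf⟩ := ih
    have := (hP.isPI (a + k)).fin
    by_cases h0 : g = 0
    · refine ⟨0, ?_, ?_⟩
      · rw [h0] at hg
        change len Λ (LinearMap.range (0 : _ →ₗ[Λ] X)) = _ at hg
        change len Λ (LinearMap.range (0 : _ →ₗ[Λ] X)) = _
        rw [LinearMap.range_zero, len_eq_zero_iff.2 inferInstance] at hg ⊢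
        lia
      · rw [show (0 : P (a + (k + 1 : ℕ)) ⟶ X).hom = 0 from rfl, LinearMap.range_zero]
        exact bot_le
    · obtain ⟨ρ, hρ⟩ : ∃ ρ : P (a + (k + 1 : ℕ)) ⟶ P (a + k), IsCoatom (LinearMap.range ρ.hom) := by
        rw [show a + (k + 1 : ℕ) = a + k + 1 by push_cast; ring]
        exact hP.exists_rad (a + k)
      have h1 := len_map_of_isCoatom (hP.isPI (a + k)).uni hρ g h0
      refine ⟨ρ ≫ g, ?_, (LinearMap.range_comp_le_range ρ.hom g.hom).trans hgf⟩
      rw [ModuleCat.hom_comp, LinearMap.range_comp]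
      lia

lemma IsInt.submodule (h : IsInt P X a b) (N : Submodule Λ X) :
    IsInt P (ModuleCat.of Λ N) (b - len Λ N) b := by
  have := h.finite hP
  have huni := h.uniserial hP
  have h0 := len_submodule_le N
  obtain ⟨⟨f, hf⟩, h⟩ := h
  obtain ⟨g, hg, -⟩ := hP.exists_range_len f (len Λ X - len Λ N)
  rw [len_range_of_surjective f.hom hf] at hg
  have hN : LinearMap.range g.hom = N := by
    refine le_antisymm (huni.le_of_len (by lia)) (huni.le_of_len (by lia))
  have e : a + (len Λ X - len Λ N : ℕ) = b - len Λ N := by lia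
  rw [← e]
  refine ⟨⟨ModuleCat.ofHom (g.hom.codRestrict N fun x => hN.le ⟨x, rfl⟩), ?_⟩, ?_⟩
  · rintro ⟨y, hy⟩
    obtain ⟨x, rfl⟩ := hN.ge hy
    exact ⟨x, rfl⟩
  · change (len Λ N : ℤ) = _
    lia

lemma IsInt.exists_submodule (h : IsInt P X a b) {l : ℕ} (hl : (l : ℤ) ≤ b - a) :
    ∃ N : Submodule Λ X, len Λ N = l := by
  obtain ⟨⟨f, hf⟩, h⟩ := h
  obtain ⟨g, hg, -⟩ := hP.exists_range_len f (len Λ X - l)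
  rw [len_range_of_surjective f.hom hf] at hg
  exact ⟨LinearMap.range g.hom, by lia⟩

omit [IsArtinianRing Λ] in
lemma CyclicFamily.isInt_self (a : ℤ) : IsInt P (P a) a (a + m) :=
  ⟨⟨𝟙 _, fun x => ⟨x, rfl⟩⟩, by rw [hP.len_eq]; ring⟩

lemma CyclicFamily.exists_isInt (h : a ≤ b) (h' : b ≤ a + m) :
    ∃ X : ModuleCat.{u} Λ, IsInt P X a b := by
  have := (hP.isPI a).fin
  obtain ⟨N, hN⟩ := (hP.isInt_self a).exists_submodule hP (l := (a + m - b).toNat) (by lia)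
  refine ⟨ModuleCat.of Λ (P a ⧸ N), ⟨ModuleCat.ofHom N.mkQ, N.mkQ_surjective⟩, ?_⟩
  have h1 := len_submodule_add_quotient N
  rw [hP.len_eq] at h1
  change (len Λ (P a ⧸ N) : ℤ) = _
  lia

lemma CyclicFamily.exists_isInt_of_indec
    (hU : ∀ X : ModuleCat.{u} Λ, Module.Finite Λ X → Indec Λ X → Uniserial Λ X)
    (hI : Injective (ModuleCat.of Λ Λ)) (hX : Module.Finite Λ X) (hXi : Indec Λ X) :
    ∃ a b, IsInt P X a b := by
  have : Nontrivial X := not_subsingleton_iff_nontrivial.1 fun h =>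
    hXi.1 (isZero_iff_subsingleton.2 h)
  obtain ⟨Q, f, hQ, hf⟩ := exists_cover hU hI X (hU X hX hXi)
  obtain ⟨a, ⟨e⟩⟩ := hP.exists_iso Q hQ
  exact ⟨a, a + len Λ X, ⟨e.inv ≫ f, hf.comp e.symm.toLinearEquiv.surjective⟩, by ring⟩

/-- The source of a nonzero map can be placed so that its left end is the left end of the range. -/
lemma IsInt.exists_shift (hY : IsInt P Y a' b') (hX : IsInt P X a b) (h : Y ⟶ X) (h0 : h ≠ 0) :
    ∃ b'', IsInt P Y (b - len Λ (LinearMap.range h.hom)) b'' ∧ b ≤ b'' := by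
  have := hX.finite hP
  have := hY.finite hP
  obtain ⟨⟨f, hf⟩, -⟩ := hX.submodule hP (LinearMap.range h.hom)
  obtain ⟨g, hg⟩ := hY.1
  let r : Y ⟶ ModuleCat.of Λ (LinearMap.range h.hom) := ModuleCat.ofHom h.hom.rangeRestrict
  have hr : Function.Surjective r.hom := h.hom.surjective_rangeRestrict
  have hgr : Function.Surjective (g ≫ r).hom := hr.comp hg
  have hgr0 : g ≫ r ≠ 0 := by
    intro h1
    refine h0 (ModuleCat.hom_ext (LinearMap.ext fun y => ?_))
    obtain ⟨x, rfl⟩ := hg y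
    exact congrArg Subtype.val (ConcreteCategory.congr_hom h1 x)
  have hiso := (hP.isPI _).iso_of_range_eq (hP.isPI _) (g ≫ r) f hgr0
    ((LinearMap.range_eq_top.2 hgr).trans (LinearMap.range_eq_top.2 hf).symm)
  refine ⟨b - len Λ (LinearMap.range h.hom) + len Λ Y, hY.shift hP
    ((hP.nonempty_iso_iff _ _).1 hiso) (by rw [← hY.2]; ring), ?_⟩
  have := len_ker_add_range h.hom
  lia

end

end Interval

section Square

variable {Λ}

lemma ext_subsingleton_of_inAdd [HasExt.{u} (ModuleCat.{u} Λ)] {M X Y : ModuleCat.{u} Λ}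
    (hX : InAdd Λ M X) (hY : InAdd Λ M Y) (n : ℕ) (h : Subsingleton (Abelian.Ext M M n)) :
    Subsingleton (Abelian.Ext X Y n) := by
  obtain ⟨r, i, p, hip⟩ := hX.exists_sum
  obtain ⟨r', i', p', hip'⟩ := hY.exists_sum
  refine subsingleton_of_forall_eq 0 fun x => ?_
  rw [← Abelian.Ext.mk₀_id_comp x, ← hip, Abelian.Ext.mk₀_sum, Abelian.Ext.sum_comp]
  refine Finset.sum_eq_zero fun j _ => ?_
  rw [← Abelian.Ext.comp_mk₀_id (Abelian.Ext.comp _ x _), ← hip', Abelian.Ext.mk₀_sum,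
    Abelian.Ext.comp_sum]
  refine Finset.sum_eq_zero fun l _ => ?_
  rw [← Abelian.Ext.mk₀_comp_mk₀ (i j), Abelian.Ext.comp_assoc_of_second_deg_zero,
    Abelian.Ext.comp_assoc_of_third_deg_zero, Abelian.Ext.comp_assoc_of_third_deg_zero,
    ← Abelian.Ext.mk₀_comp_mk₀, ← Abelian.Ext.comp_assoc_of_third_deg_zero x,
    ← Abelian.Ext.comp_assoc_of_third_deg_zero (Abelian.Ext.mk₀ (p j)),
    h.elim (Abelian.Ext.comp (Abelian.Ext.mk₀ (p j)) _ _) 0]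
  simp

variable {V X : ModuleCat.{u} Λ} (g : V ⟶ X) (D : Submodule Λ X)

/-- The map from the preimage of `D` to `D`. -/
noncomputable def comapMap : ModuleCat.of Λ (D.comap g.hom) ⟶ ModuleCat.of Λ D :=
  ModuleCat.ofHom (g.hom.restrict fun _ hx => hx)

/-- The sequence attached to the pullback square of a map `g` and a submodule `D` of its target. -/
noncomputable def square : ShortComplex (ModuleCat.{u} Λ) where
  X₁ := ModuleCat.of Λ (D.comap g.hom)
  X₂ := V ⊞ ModuleCat.of Λ D
  X₃ := X
  f := biprod.lift (ModuleCat.ofHom (D.comap g.hom).subtype) (-comapMap g D)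
  g := biprod.desc g (ModuleCat.ofHom D.subtype)
  zero := by
    rw [biprod.lift_desc, Preadditive.neg_comp, ← sub_eq_add_neg, sub_eq_zero]
    rfl

lemma square_shortExact (hg : Function.Surjective g.hom) : (square g D).ShortExact where
  exact := by
    rw [ShortComplex.moduleCat_exact_iff]
    intro x hx
    change (V ⊞ ModuleCat.of Λ D : ModuleCat Λ) at x
    let G : V ⊞ ModuleCat.of Λ D ⟶ X := biprod.desc g (ModuleCat.ofHom D.subtype)
    have hx' : G.hom x = 0 := hx
    have htot := ConcreteCategory.congr_hom
      (biprod.total (X := V) (Y := ModuleCat.of Λ D)) x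
    set v : V := (biprod.fst : V ⊞ ModuleCat.of Λ D ⟶ V).hom x
    set w : D := (biprod.snd : V ⊞ ModuleCat.of Λ D ⟶ _).hom x
    have htot' : (biprod.inl : V ⟶ V ⊞ ModuleCat.of Λ D).hom v +
      (biprod.inr : _ ⟶ V ⊞ ModuleCat.of Λ D).hom w = x := htot
    have hinl (y : V) : G.hom ((biprod.inl : V ⟶ V ⊞ ModuleCat.of Λ D).hom y) = g.hom y :=
      ConcreteCategory.congr_hom (biprod.inl_desc g (ModuleCat.ofHom D.subtype)) y
    have hinr (y : D) : G.hom ((biprod.inr : _ ⟶ V ⊞ ModuleCat.of Λ D).hom y) = (y : X) :=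
      ConcreteCategory.congr_hom (biprod.inr_desc g (ModuleCat.ofHom D.subtype)) y
    have hvw : g.hom v = -(w : X) := by
      rw [eq_neg_iff_add_eq_zero, ← hinl, ← hinr, ← map_add, htot', hx']
    have hv : v ∈ D.comap g.hom := by
      change g.hom v ∈ D
      rw [hvw]
      exact D.neg_mem w.2
    refine ⟨⟨v, hv⟩, ?_⟩
    have hf : (square g D).f = ModuleCat.ofHom (D.comap g.hom).subtype ≫ biprod.inl +
        (-comapMap g D) ≫ biprod.inr := biprod.lift_eq
    have hw : -(comapMap g D).hom ⟨v, hv⟩ = w := Subtype.ext (neg_eq_iff_eq_neg.2 hvw)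
    rw [hf]
    refine Eq.trans ?_ htot'
    rw [← hw]
    rfl
  mono_f := by
    have h : biprod.lift (ModuleCat.ofHom (D.comap g.hom).subtype) (-comapMap g D) ≫ biprod.fst =
      ModuleCat.ofHom (D.comap g.hom).subtype := biprod.lift_fst _ _
    have : Mono (ModuleCat.ofHom (D.comap g.hom).subtype) :=
      (ModuleCat.mono_iff_injective _).2 (Submodule.injective_subtype _)
    have h' : Mono (biprod.lift (ModuleCat.ofHom (D.comap g.hom).subtype) (-comapMap g D)) :=
      mono_of_mono_fac h
    exact h'
  epi_g := by
    have h : biprod.inl ≫ biprod.desc g (ModuleCat.ofHom D.subtype) = g := biprod.inl_desc _ _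
    have : Epi g := (ModuleCat.epi_iff_surjective _).2 hg
    have h' : Epi (biprod.desc g (ModuleCat.ofHom D.subtype)) := epi_of_epi_fac h
    exact h'

variable [IsArtinianRing Λ]

lemma square_not_split [Module.Finite Λ X] [Module.Finite Λ V] (hX : Uniserial Λ X)
    (hV : Uniserial Λ V) (hD : D ≠ ⊤) (hl : len Λ X < len Λ V) :
    ¬ ∃ s : (square g D).X₃ ⟶ (square g D).X₂, s ≫ (square g D).g = 𝟙 _ := by
  rintro ⟨s, hs⟩
  change X ⟶ V ⊞ ModuleCat.of Λ D at s
  have hs' : s ≫ biprod.desc g (ModuleCat.ofHom D.subtype) = 𝟙 X := hs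
  rw [biprod.desc_eq, Preadditive.comp_add] at hs'
  have hsum (x : X) : g.hom ((s ≫ biprod.fst).hom x) + ((s ≫ biprod.snd).hom x : D) = x :=
    ConcreteCategory.congr_hom hs' x
  have htop : LinearMap.range (g.hom ∘ₗ (s ≫ biprod.fst).hom) ⊔ D = ⊤ := by
    refine eq_top_iff.2 fun x _ => ?_
    rw [← hsum x]
    exact Submodule.add_mem_sup ⟨x, rfl⟩ (Subtype.property _)
  have h1 := (hX.eq_top_of_sup htop).resolve_right hD
  have hg0 : g.hom ≠ 0 := by
    intro h0
    rw [h0, LinearMap.zero_comp, LinearMap.range_zero] at h1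
    exact hD (eq_top_iff.2 (h1 ▸ bot_le))
  have h2 := hV.surjective_of_comp g.hom hg0 (s ≫ biprod.fst).hom
    (le_antisymm (LinearMap.range_comp_le_range _ _) (by rw [h1]; exact le_top))
  have := len_le_of_surjective _ h2
  lia

lemma len_comap_le_of_injective {Y Z : Type u} [AddCommGroup Y] [Module Λ Y] [AddCommGroup Z]
    [Module Λ Z] [Module.Finite Λ Y] [Module.Finite Λ Z] (f : Y →ₗ[Λ] Z)
    (hf : Function.Injective f) (K : Submodule Λ Z) : len Λ (K.comap f) ≤ len Λ K :=
  len_le_of_injective (f.restrict (p := K.comap f) (q := K) fun _ hx => hx)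
    fun _ _ hxy => Subtype.ext (hf (congrArg (fun z : K => (z : Z)) hxy))

lemma len_comap [Module.Finite Λ X] [Module.Finite Λ V] (hg : Function.Surjective g.hom) :
    len Λ (D.comap g.hom) + len Λ X = len Λ D + len Λ V := by
  have h1 := len_ker_add_range g.hom
  rw [len_range_of_surjective g.hom hg] at h1
  let r : D.comap g.hom →ₗ[Λ] D := g.hom.restrict fun _ hx => hx
  have h2 := len_ker_add_range r
  have hr : Function.Surjective r := fun ⟨y, hy⟩ => by
    obtain ⟨x, rfl⟩ := hg y
    exact ⟨⟨x, hy⟩, rfl⟩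
  have hk : LinearMap.ker r = (LinearMap.ker g.hom).submoduleOf (D.comap g.hom) := by
    ext x
    exact Subtype.ext_iff
  have h3 : LinearMap.ker g.hom ≤ D.comap g.hom := fun x hx => by
    change g.hom x ∈ D
    rw [LinearMap.mem_ker.1 hx]
    exact D.zero_mem
  rw [len_range_of_surjective r hr, hk, len_congr Λ (Submodule.submoduleOfEquivOfLe h3)] at h2
  lia

lemma le_len_map_add [Module.Finite Λ X] [Module.Finite Λ V] (hg : Function.Surjective g.hom)
    (W : Submodule Λ V) : len Λ W + len Λ X ≤ len Λ (W.map g.hom) + len Λ V := by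
  have h1 := len_ker_add_range g.hom
  rw [len_range_of_surjective g.hom hg] at h1
  have h2 := len_ker_add_range (g.hom ∘ₗ W.subtype)
  rw [LinearMap.range_comp, Submodule.range_subtype, LinearMap.ker_comp] at h2
  have h3 := len_comap_le_of_injective W.subtype W.injective_subtype (LinearMap.ker g.hom)
  lia

end Square

section Rigid

variable {Λ} [IsArtinianRing Λ] {P : ℤ → ModuleCat.{u} Λ} {n m : ℕ} {M X : ModuleCat.{u} Λ}
  {a b c d : ℤ}

/-- A quotient of `P a` of length between `n` and `m - n` has a self-extension. -/
lemma IsInt.not_subsingleton_ext [HasExt.{u} (ModuleCat.{u} Λ)] (hX : IsInt P X a b)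
    (hP : CyclicFamily n m P) (hn : 0 < n) (h1 : a + n ≤ b) (h2 : b + n ≤ a + m) :
    ¬ Subsingleton (Abelian.Ext X X 1) := by
  intro hE
  obtain ⟨V, hV⟩ := hP.exists_isInt (a := a) (b := b + n) (by lia) h2
  obtain ⟨g, hg⟩ := hV.exists_surjective hP hX (by lia)
  obtain ⟨D, hD⟩ := hX.exists_submodule hP (l := (b - a - n).toNat) (by lia)
  have := hV.finite hP
  have := hX.finite hP
  have hVl := hV.2
  have hXl := hX.2
  have hC := hV.submodule hP (D.comap g.hom)
  have hCl := len_comap g D hg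
  obtain ⟨i⟩ := (hC.shift (a' := a) (b' := b) hP
    (by rw [show b + n - (len Λ (D.comap g.hom) : ℤ) = a + n by lia]
        simp [Int.ModEq]) (by lia)).nonempty_iso hP hX
  have hEC : Subsingleton (Abelian.Ext X (square g D).X₁ 1) :=
    ext_subsingleton_of_inAdd (inAdd_self X) ((inAdd_self X).of_iso i) 1 hE
  have hS := square_shortExact g D hg
  obtain ⟨x, hx⟩ := Abelian.Ext.covariant_sequence_exact₃ X hS
    (Abelian.Ext.mk₀ (𝟙 X)) (zero_add 1) (hEC.elim _ _)
  obtain ⟨s, rfl⟩ := (Abelian.Ext.mk₀_bijective _ _).2 x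
  rw [Abelian.Ext.mk₀_comp_mk₀] at hx
  refine square_not_split g D (hX.uniserial hP) (hV.uniserial hP) ?_ (by lia)
    ⟨s, (Abelian.Ext.mk₀_bijective _ _).1 hx⟩
  rintro rfl
  rw [len_top] at hD
  lia

end Rigid

section Step

variable {Λ} [IsArtinianRing Λ] {P : ℤ → ModuleCat.{u} Λ} {n m : ℕ} {M X V : ModuleCat.{u} Λ}
  {a b c d : ℤ}

lemma exists_lift_of_forall_indec {T : ModuleCat.{u} Λ} (g : T ⟶ X)
    (h : ∀ Y : ModuleCat.{u} Λ, Module.Finite Λ Y → Indec Λ Y → InAdd Λ M Y → ∀ f : Y ⟶ X,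
      ∃ s : Y ⟶ T, s ≫ g = f)
    {Y : ModuleCat.{u} Λ} (hY : Module.Finite Λ Y) (hYM : InAdd Λ M Y) (f : Y ⟶ X) :
    ∃ s : Y ⟶ T, s ≫ g = f := by
  refine fg_induction (Λ := Λ) (fun Y => InAdd Λ M Y → ∀ f : Y ⟶ X,
    ∃ s : Y ⟶ T, s ≫ g = f) ?_ ?_ ?_ h Y hY hYM f
  · intro Y Z e hY hZM f
    obtain ⟨s, hs⟩ := hY (hZM.of_iso e) (e.hom ≫ f)
    exact ⟨e.inv ≫ s, by rw [Category.assoc, hs, e.inv_hom_id_assoc]⟩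
  · intro Y hY _ f
    exact ⟨0, hY.eq_of_src _ _⟩
  · intro Y Z hY hZ hYZ f
    obtain ⟨s, hs⟩ := hY (hYZ.of_retract ⟨biprod.inl, biprod.fst, biprod.inl_fst⟩)
      (biprod.inl ≫ f)
    obtain ⟨t, ht⟩ := hZ (hYZ.of_retract ⟨biprod.inr, biprod.snd, biprod.inr_snd⟩)
      (biprod.inr ≫ f)
    exact ⟨biprod.desc s t, biprod.hom_ext' _ _ (by simp [hs]) (by simp [ht])⟩

lemma CyclicFamily.exists_lift_square (hP : CyclicFamily n m P)
    (hU : ∀ X : ModuleCat.{u} Λ, Module.Finite Λ X → Indec Λ X → Uniserial Λ X)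
    (hI : Injective (ModuleCat.of Λ Λ)) (hX : IsInt P X a b) (hV : IsInt P V a d) (hbd : b ≤ d)
    (g : V ⟶ X) (hg : Function.Surjective g.hom) (D : Submodule Λ X) (hD : (len Λ D : ℤ) = b - c)
    (h : ∀ (N : ModuleCat.{u} Λ) (a' b' : ℤ), IsInt P N a' b' → InAdd Λ M N → a ≤ a' → b ≤ b' →
      c ≤ a' ∨ d ≤ b')
    (Y : ModuleCat.{u} Λ) (hY : Module.Finite Λ Y) (hYM : InAdd Λ M Y) (f : Y ⟶ X) :
    ∃ s : Y ⟶ (square g D).X₂, s ≫ (square g D).g = f := by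
  refine exists_lift_of_forall_indec (square g D).g (fun Y hY hYi hYM (f : Y ⟶ X) => ?_) hY hYM f
  by_cases h0 : f = 0
  · exact ⟨0, zero_comp.trans h0.symm⟩
  obtain ⟨a', b', hYint⟩ := hP.exists_isInt_of_indec hU hI hY hYi
  obtain ⟨b'', hY', hb⟩ := hYint.exists_shift hP hX f h0
  have := hX.finite hP
  have := hV.finite hP
  have hXl := hX.2
  have hVl := hV.2
  have hYl := hY'.2
  have hfl := len_submodule_le (LinearMap.range f.hom)
  rcases h Y _ _ hY' hYM (by lia) hb with h | h
  · have hr : LinearMap.range f.hom ≤ D := (hX.uniserial hP).le_of_len (by lia)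
    let s : Y ⟶ ModuleCat.of Λ D :=
      ModuleCat.ofHom (f.hom.codRestrict D fun y => hr ⟨y, rfl⟩)
    refine ⟨s ≫ (biprod.inr : ModuleCat.of Λ D ⟶ V ⊞ ModuleCat.of Λ D), ?_⟩
    have h1 : (s ≫ biprod.inr) ≫ biprod.desc g (ModuleCat.ofHom D.subtype) = f := by
      rw [Category.assoc, biprod.inr_desc]
      rfl
    exact h1
  · obtain ⟨W, hW⟩ := hV.exists_submodule hP
      (l := (len Λ (LinearMap.range f.hom) + (d - b)).toNat) (by lia)
    have hWl := le_len_map_add g hg W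
    have hr : LinearMap.range f.hom ≤ W.map g.hom := (hX.uniserial hP).le_of_len (by lia)
    obtain ⟨p, hp⟩ := hY'.1
    let w : ModuleCat.of Λ W ⟶ V := ModuleCat.ofHom W.subtype
    have hw : LinearMap.range (w ≫ g).hom = W.map g.hom := by
      rw [ModuleCat.hom_comp, LinearMap.range_comp]
      exact congrArg (Submodule.map g.hom) W.range_subtype
    obtain ⟨s, hs⟩ := exists_lift_of_len_le (hP.isPI _) p hp f (w ≫ g) (by rwa [hw])
      (by change len Λ W ≤ _; lia)
    refine ⟨(s ≫ w) ≫ (biprod.inl : V ⟶ V ⊞ ModuleCat.of Λ D), ?_⟩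
    have h1 : ((s ≫ w) ≫ biprod.inl) ≫ biprod.desc g (ModuleCat.ofHom D.subtype) = f := by
      rw [Category.assoc, biprod.inl_desc, Category.assoc, hs]
    exact h1

/-- One step of a resolution by `add M`: under suitable conditions on the intervals that belong to
`add M`, passing from `[a, b)` to `[c, d)` lowers the projective dimension. -/
lemma CyclicFamily.exists_syzygy (hP : CyclicFamily n m P)
    (hU : ∀ X : ModuleCat.{u} Λ, Module.Finite Λ X → Indec Λ X → Uniserial Λ X)
    (hI : Injective (ModuleCat.of Λ Λ)) {A : Type u} [Ring A] (e : A ≃+* (End M)ᵐᵒᵖ)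
    (hMf : Module.Finite Λ M) (hM : InAdd Λ M (ModuleCat.of Λ Λ))
    (hX : IsInt P X a b) (hac : a < c) (hcb : c ≤ b) (hbd : b < d) (hdm : d ≤ a + m)
    (h : ∀ (N : ModuleCat.{u} Λ) (a' b' : ℤ), IsInt P N a' b' → InAdd Λ M N → a ≤ a' → b ≤ b' →
      c ≤ a' ∨ d ≤ b')
    (hL : ∃ (L : ModuleCat.{u} Λ) (a' : ℤ), a ≤ a' ∧ a' ≤ c ∧ IsInt P L a' d ∧ InAdd Λ M L)
    (hS : ∃ (S : ModuleCat.{u} Λ) (b' : ℤ), b ≤ b' ∧ b' ≤ d ∧ IsInt P S c b' ∧ InAdd Λ M S) :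
    ∃ K : ModuleCat.{u} Λ, IsInt P K c d ∧
      (∀ r, HasProjectiveDimensionLT ((homFunctor e).obj X) (r + 2) →
        HasProjectiveDimensionLT ((homFunctor e).obj K) (r + 1)) ∧
      ¬ Projective ((homFunctor e).obj X) := by
  obtain ⟨V, hV⟩ := hP.exists_isInt (a := a) (b := d) (by lia) hdm
  obtain ⟨g, hg⟩ := hV.exists_surjective hP hX hbd.le
  obtain ⟨D, hD⟩ := hX.exists_submodule hP (l := (b - c).toNat) (by lia)
  have := hV.finite hP
  have := hX.finite hP
  have hVl := hV.2
  have hXl := hX.2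
  have hKl := len_comap g D hg
  have hK := hV.submodule hP (D.comap g.hom)
  rw [show d - (len Λ (D.comap g.hom) : ℤ) = c by lia] at hK
  have hsq := square_shortExact g D hg
  have hlift := fun f => hP.exists_lift_square hU hI hX hV hbd.le g hg D (c := c) (by lia) h M hMf
    (inAdd_self M) f
  refine ⟨_, hK, ?_, fun hp => square_not_split g D (hX.uniserial hP) (hV.uniserial hP) ?_ (by lia)
    (homFunctor_split e hM hsq hlift hp)⟩
  swap
  · rintro rfl
    rw [len_top] at hD
    lia
  obtain ⟨L, a', haa, hac', hL, hLM⟩ := hL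
  obtain ⟨W, hW⟩ := hV.exists_submodule hP (l := (d - a').toNat) (by lia)
  have hWi := hV.submodule hP W
  rw [show d - (len Λ W : ℤ) = a' by lia] at hWi
  obtain ⟨i⟩ := hWi.nonempty_iso hP hL
  have hWM := hLM.of_iso i
  have hKW : D.comap g.hom ≤ W := (hV.uniserial hP).le_of_len (by lia)
  obtain ⟨S, q, q', hSM, hqq⟩ : ∃ (S : ModuleCat.{u} Λ) (q : ModuleCat.of Λ (D.comap g.hom) ⟶ S)
      (q' : S ⟶ ModuleCat.of Λ D), InAdd Λ M S ∧ q ≫ q' = -comapMap g D := by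
    obtain ⟨S, b', hb, hbd', hS, hSM⟩ := hS
    obtain ⟨q, hq⟩ := hK.exists_surjective hP hS hbd'
    have := hK.finite hP
    have hSl := hS.2
    have hrl := len_submodule_le (LinearMap.range (-comapMap g D).hom)
    have hrl' : len Λ (LinearMap.range (-comapMap g D).hom) ≤ len Λ D := hrl
    obtain ⟨q', hq'⟩ := exists_factor_of_len_le (hK.uniserial hP) q hq (-comapMap g D) (by lia)
    exact ⟨S, q, q', hSM, hq'⟩
  let incl : ModuleCat.of Λ (D.comap g.hom) ⟶ ModuleCat.of Λ W :=
    ModuleCat.ofHom (Submodule.inclusion hKW)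
  let w : ModuleCat.of Λ W ⟶ V := ModuleCat.ofHom W.subtype
  have hab : biprod.lift incl q ≫ biprod.map w q' = (square g D).f := by
    refine biprod.hom_ext _ _ ?_ ?_
    · rw [Category.assoc, biprod.map_fst, biprod.lift_fst_assoc]
      exact (biprod.lift_fst (ModuleCat.ofHom (D.comap g.hom).subtype) (-comapMap g D)).symm
    · rw [Category.assoc, biprod.map_snd, biprod.lift_snd_assoc, hqq]
      exact (biprod.lift_snd (ModuleCat.ofHom (D.comap g.hom).subtype) (-comapMap g D)).symm
  exact fun r => homFunctor_syzygy e hsq hlift (hWM.biprod hSM) _ _ hab r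

end Step

section Combinatorics

/-- `c` is the least left end of an interval in `𝓜` of length less than `n` whose right end is at
least `b`. -/
def IsLeastShort (𝓜 : ℤ → ℤ → Prop) (n : ℕ) (b c : ℤ) : Prop :=
  (∃ b', b ≤ b' ∧ b' ≤ c + n - 1 ∧ 𝓜 c b') ∧
    ∀ a' b', 𝓜 a' b' → b' - a' ≤ n - 1 → b ≤ b' → c ≤ a'

/-- `d` is the least right end of an interval in `𝓜` of length greater than `m - n` whose left end
is at least `a`. -/
def IsLeastLong (𝓜 : ℤ → ℤ → Prop) (n m : ℕ) (a d : ℤ) : Prop :=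
  (∃ a', a ≤ a' ∧ a' + m - n + 1 ≤ d ∧ 𝓜 a' d) ∧
    ∀ a' b', 𝓜 a' b' → (m : ℤ) - n + 1 ≤ b' - a' → a ≤ a' → d ≤ b'

variable {𝓜 : ℤ → ℤ → Prop} {n m : ℕ} {a b c d : ℤ}

lemma exists_isLeastShort (hn : 0 < n) (h : ∀ a, 𝓜 a a) (b : ℤ) : ∃ c, IsLeastShort 𝓜 n b c := by
  obtain ⟨c, ⟨b', hb, hc, hM⟩, hmin⟩ := Int.exists_least_of_bdd
    (P := fun c => ∃ b', b ≤ b' ∧ b' ≤ c + n - 1 ∧ 𝓜 c b')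
    ⟨b - n + 1, fun c ⟨b', hb, hc, _⟩ => by lia⟩ ⟨b, b, le_rfl, by lia, h b⟩
  exact ⟨c, ⟨b', hb, hc, hM⟩, fun a' b' hM' hl hb' => hmin a' ⟨b', hb', by lia, hM'⟩⟩

lemma exists_isLeastLong (hn : 0 < n) (h : ∀ a, 𝓜 a (a + m)) (a : ℤ) :
    ∃ d, IsLeastLong 𝓜 n m a d := by
  obtain ⟨d, ⟨a', ha, hd, hM⟩, hmin⟩ := Int.exists_least_of_bdd
    (P := fun d => ∃ a', a ≤ a' ∧ a' + m - n + 1 ≤ d ∧ 𝓜 a' d)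
    ⟨a + m - n + 1, fun d ⟨a', ha, hd, _⟩ => by lia⟩ ⟨a + m, a, le_rfl, by lia, h a⟩
  exact ⟨d, ⟨a', ha, hd, hM⟩, fun a' b' hM' hl ha' => hmin b' ⟨a', ha', by lia, hM'⟩⟩

lemma IsLeastShort.shift (hc : IsLeastShort 𝓜 n b c) (h : ∀ a b, 𝓜 (a + n) (b + n) ↔ 𝓜 a b) :
    IsLeastShort 𝓜 n (b + n) (c + n) := by
  obtain ⟨⟨b', hb, hc, hM⟩, hmin⟩ := hc
  refine ⟨⟨b' + n, by lia, by lia, (h _ _).2 hM⟩, fun a' b' hM' hl hb' => ?_⟩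
  have := hmin (a' - n) (b' - n) ((h _ _).1 (by simpa using hM')) (by lia) (by lia)
  lia

lemma IsLeastLong.shift (hd : IsLeastLong 𝓜 n m a d) (h : ∀ a b, 𝓜 (a + n) (b + n) ↔ 𝓜 a b) :
    IsLeastLong 𝓜 n m (a + n) (d + n) := by
  obtain ⟨⟨a', ha, hd, hM⟩, hmin⟩ := hd
  refine ⟨⟨a' + n, by lia, by lia, (h _ _).2 hM⟩, fun a' b' hM' hl ha' => ?_⟩
  have := hmin (a' - n) (b' - n) ((h _ _).1 (by simpa using hM')) (by lia) (by lia)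
  lia

end Combinatorics

section InfiniteDimension

variable {Λ} [IsArtinianRing Λ] {P : ℤ → ModuleCat.{u} Λ} {n m : ℕ} {M X : ModuleCat.{u} Λ}
  {a b : ℤ}

/-- The intervals `[a, b)` whose module belongs to `add M`. -/
def intAdd (P : ℤ → ModuleCat.{u} Λ) (M : ModuleCat.{u} Λ) (a b : ℤ) : Prop :=
  ∃ X : ModuleCat.{u} Λ, IsInt P X a b ∧ InAdd Λ M X

omit [IsArtinianRing Λ] in
lemma CyclicFamily.intAdd_shift (hP : CyclicFamily n m P) (a b : ℤ) :
    intAdd P M (a + n) (b + n) ↔ intAdd P M a b :=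
  ⟨fun ⟨X, hX, hXM⟩ => ⟨X, hX.shift hP (by simp [Int.ModEq]) (by ring), hXM⟩,
    fun ⟨X, hX, hXM⟩ => ⟨X, hX.shift hP (by simp [Int.ModEq]) (by ring), hXM⟩⟩

lemma CyclicFamily.intAdd_self (hP : CyclicFamily n m P) (a : ℤ) : intAdd P M a a := by
  obtain ⟨X, hX⟩ := hP.exists_isInt (a := a) le_rfl (by lia)
  have := hX.finite hP
  have hXl := hX.2
  have h0 : len Λ X = 0 := by lia
  exact ⟨X, hX, inAdd_of_isZero (isZero_iff_subsingleton.2 (len_eq_zero_iff.1 h0))⟩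

omit [IsArtinianRing Λ] in
lemma CyclicFamily.intAdd_add (hP : CyclicFamily n m P) (hM : IsGenCogen Λ M) (a : ℤ) :
    intAdd P M a (a + m) :=
  ⟨P a, hP.isInt_self a, hM.2 _ (hP.isPI a).fin (hP.isPI a).inj⟩

lemma intAdd.short_or_long [HasExt.{u} (ModuleCat.{u} Λ)] (h : intAdd P M a b)
    (hP : CyclicFamily n m P) (hn : 0 < n) (hE : Subsingleton (Abelian.Ext M M 1)) :
    b - a ≤ n - 1 ∨ (m : ℤ) - n + 1 ≤ b - a := by
  obtain ⟨X, hX, hXM⟩ := h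
  by_contra! hcon
  exact hX.not_subsingleton_ext hP hn (by lia) (by lia) (ext_subsingleton_of_inAdd hXM hXM 1 hE)

variable {A : Type u} [Ring A] (e : A ≃+* (End M)ᵐᵒᵖ)

/-- The intervals that occur in the resolution constructed below. -/
def IsAdmissible (n m : ℕ) (P : ℤ → ModuleCat.{u} Λ) (M : ModuleCat.{u} Λ) (a b : ℤ) : Prop :=
  IsLeastShort (intAdd P M) n b (a + n) ∨ IsLeastLong (intAdd P M) n m (a - n) b

lemma CyclicFamily.exists_admissible_syzygy [HasExt.{u} (ModuleCat.{u} Λ)]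
    (hP : CyclicFamily n m P)
    (hU : ∀ X : ModuleCat.{u} Λ, Module.Finite Λ X → Indec Λ X → Uniserial Λ X)
    (hI : Injective (ModuleCat.of Λ Λ)) (hMf : Module.Finite Λ M) (hM : IsGenCogen Λ M)
    (hn : 0 < n) (hnm : 3 * n ≤ m) (hE : Subsingleton (Abelian.Ext M M 1))
    (hX : IsInt P X a b) (hab : IsAdmissible n m P M a b) :
    ∃ (K : ModuleCat.{u} Λ) (c d : ℤ), IsInt P K c d ∧ IsAdmissible n m P M c d ∧
      (∀ r, HasProjectiveDimensionLT ((homFunctor e).obj X) (r + 2) →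
        HasProjectiveDimensionLT ((homFunctor e).obj K) (r + 1)) ∧
      ¬ Projective ((homFunctor e).obj X) := by
  obtain ⟨c, d, hc, hd, hcd, hac, hbd, hcd₁, hcd₂⟩ : ∃ c d, IsLeastShort (intAdd P M) n b c ∧
      IsLeastLong (intAdd P M) n m a d ∧ IsAdmissible n m P M c d ∧ a < c ∧ b < d ∧
      c + n - 1 ≤ d ∧ d ≤ c + m - n + 1 := by
    rcases hab with h | h
    · obtain ⟨d, hd⟩ := exists_isLeastLong hn (hP.intAdd_add hM) a
      have h1 := h.1
      have h2 := hd.1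
      have h3 := hd.2 a (a + m) (hP.intAdd_add hM a) (by lia) le_rfl
      obtain ⟨b', h1⟩ := h1
      obtain ⟨a', h2⟩ := h2
      exact ⟨a + n, d, h, hd, Or.inr (by simpa using hd), by lia, by lia, by lia, by lia⟩
    · obtain ⟨c, hc⟩ := exists_isLeastShort hn (hP.intAdd_self (M := M)) b
      have h1 := h.1
      have h2 := hc.1
      have hd := h.shift hP.intAdd_shift
      rw [sub_add_cancel] at hd
      have h3 := hc.2 b b (hP.intAdd_self b) (by lia) le_rfl
      obtain ⟨a', h1⟩ := h1
      obtain ⟨b', h2⟩ := h2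
      exact ⟨c, b + n, hc, hd, Or.inl (hc.shift hP.intAdd_shift), by lia, by lia, by lia, by lia⟩
  have hcb := hc.2 b b (hP.intAdd_self b) (by lia) le_rfl
  have hdm := hd.2 a (a + m) (hP.intAdd_add hM a) (by lia) le_rfl
  obtain ⟨b', hb', hb'c, S, hS, hSM⟩ := hc.1
  obtain ⟨a', ha', ha'd, L, hL, hLM⟩ := hd.1
  have hi : ∀ (N : ModuleCat.{u} Λ) (a' b' : ℤ), IsInt P N a' b' → InAdd Λ M N → a ≤ a' → b ≤ b' →
      c ≤ a' ∨ d ≤ b' := fun N a' b' hN hNM ha hb =>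
    have hNi : intAdd P M a' b' := ⟨N, hN, hNM⟩
    (hNi.short_or_long hP hn hE).imp (fun h => hc.2 a' b' hNi h hb) fun h => hd.2 a' b' hNi h ha
  obtain ⟨K, hK, hKX⟩ := hP.exists_syzygy hU hI e hMf hM.1 hX hac hcb hbd hdm hi
    ⟨L, a', ha', by lia, hL, hLM⟩ ⟨S, b', hb', by lia, hS, hSM⟩
  exact ⟨K, c, d, hK, hcd, hKX⟩

lemma CyclicFamily.not_hasProjectiveDimensionLT [HasExt.{u} (ModuleCat.{u} Λ)]
    (hP : CyclicFamily n m P)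
    (hU : ∀ X : ModuleCat.{u} Λ, Module.Finite Λ X → Indec Λ X → Uniserial Λ X)
    (hI : Injective (ModuleCat.of Λ Λ)) (hMf : Module.Finite Λ M) (hM : IsGenCogen Λ M)
    (hn : 0 < n) (hnm : 3 * n ≤ m) (hE : Subsingleton (Abelian.Ext M M 1)) (r : ℕ)
    (X : ModuleCat.{u} Λ) (a b : ℤ) (hX : IsInt P X a b) (hab : IsAdmissible n m P M a b) :
    ¬ HasProjectiveDimensionLT ((homFunctor e).obj X) (r + 1) := by
  induction r generalizing X a b with
  | zero =>
    obtain ⟨K, c, d, -, -, -, h⟩ :=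
      hP.exists_admissible_syzygy e hU hI hMf hM hn hnm hE hX hab
    exact fun h' => h ((projective_iff_hasProjectiveDimensionLT_one).2 h')
  | succ r ih =>
    obtain ⟨K, c, d, hK, hcd, h, -⟩ :=
      hP.exists_admissible_syzygy e hU hI hMf hM hn hnm hE hX hab
    exact fun h' => ih K c d hK hcd (h r h')

lemma CyclicFamily.not_gldimLE [HasExt.{u} (ModuleCat.{u} Λ)]
    (hP : CyclicFamily n m P)
    (hU : ∀ X : ModuleCat.{u} Λ, Module.Finite Λ X → Indec Λ X → Uniserial Λ X)
    (hI : Injective (ModuleCat.of Λ Λ)) (hMf : Module.Finite Λ M) (hM : IsGenCogen Λ M)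
    (hn : 0 < n) (hnm : 3 * n ≤ m) (hE : Subsingleton (Abelian.Ext M M 1)) (r : ℕ) :
    ¬ GldimLE (End (op M)) r := by
  intro hr
  obtain ⟨d, hd⟩ := exists_isLeastLong hn (hP.intAdd_add hM) 0
  have hdm := hd.2 0 (0 + m) (hP.intAdd_add hM 0) (by lia) le_rfl
  obtain ⟨X, hX⟩ := hP.exists_isInt (a := n) (b := d) (by obtain ⟨a', h⟩ := hd.1; lia) (by lia)
  exact hP.not_hasProjectiveDimensionLT (endOpRingEquiv M) hU hI hMf hM hn hnm hE r X n d hX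
    (Or.inr (by simpa using hd)) (hasProjectiveDimensionLT_of_projDimLE _ _ (hr _))

end InfiniteDimension

section Auslander

variable {Λ} [IsArtinianRing Λ] {P : ℤ → ModuleCat.{u} Λ} {n m : ℕ}

lemma CyclicFamily.exists_mono_injective (hP : CyclicFamily n m P)
    (hU : ∀ X : ModuleCat.{u} Λ, Module.Finite Λ X → Indec Λ X → Uniserial Λ X)
    (hI : Injective (ModuleCat.of Λ Λ)) (X : ModuleCat.{u} Λ) (hX : Module.Finite Λ X) :
    ∃ (E : ModuleCat.{u} Λ) (φ : X ⟶ E), Module.Finite Λ E ∧ Injective E ∧ Mono φ := by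
  refine fg_induction (Λ := Λ) (fun X => ∃ (E : ModuleCat.{u} Λ) (φ : X ⟶ E),
    Module.Finite Λ E ∧ Injective E ∧ Mono φ) ?_ ?_ ?_ ?_ X hX
  · rintro X Y e ⟨E, φ, hE, hEi, hφ⟩
    exact ⟨E, e.inv ≫ φ, hE, hEi, inferInstance⟩
  · intro X hX
    have := isZero_iff_subsingleton.1 hX
    exact ⟨X, 𝟙 X, inferInstance, hX.injective, inferInstance⟩
  · rintro X Y ⟨E, φ, hE, hEi, hφ⟩ ⟨F, ψ, hF, hFi, hψ⟩
    have : Module.Finite Λ (ModuleCat.of Λ (E × F)) := inferInstanceAs (Module.Finite Λ (E × F))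
    exact ⟨E ⊞ F, biprod.map φ ψ, finite_of_iso (ModuleCat.biprodIsoProd E F).symm this,
      inferInstance, inferInstance⟩
  · intro X hX hXi
    obtain ⟨a, b, hX⟩ := hP.exists_isInt_of_indec hU hI hX hXi
    have hba := hX.sub_le hP
    have hXl := hX.2
    have hQ := hP.isInt_self (b - m)
    obtain ⟨N, hN⟩ := hQ.exists_submodule hP (l := (b - a).toNat) (by lia)
    have hNi := hQ.submodule hP N
    rw [sub_add_cancel, show b - (len Λ N : ℤ) = a by lia] at hNi
    obtain ⟨i⟩ := hX.nonempty_iso hP hNi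
    have : Mono (ModuleCat.ofHom N.subtype) :=
      (ModuleCat.mono_iff_injective _).2 N.injective_subtype
    exact ⟨P (b - m), i.hom ≫ ModuleCat.ofHom N.subtype, (hP.isPI _).fin, (hP.isPI _).inj,
      inferInstance⟩

/-- There is a finitely generated module of which every finitely generated module is a summand up
to multiplicity. -/
lemma CyclicFamily.exists_forall_inAdd (hP : CyclicFamily n m P) (hn : 0 < n)
    (hU : ∀ X : ModuleCat.{u} Λ, Module.Finite Λ X → Indec Λ X → Uniserial Λ X)
    (hI : Injective (ModuleCat.of Λ Λ)) : ∃ M : ModuleCat.{u} Λ, Module.Finite Λ M ∧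
      ∀ X : ModuleCat.{u} Λ, Module.Finite Λ X → InAdd Λ M X := by
  have hex (i : Fin n × Fin (m + 1)) : ∃ X : ModuleCat.{u} Λ, IsInt P X i.1 (i.1 + i.2) :=
    hP.exists_isInt (by lia) (by have := i.2.is_lt; lia)
  choose F hF using hex
  have hFf (i) : Module.Finite Λ (F i) := (hF i).finite hP
  have hfin : Module.Finite Λ (ModuleCat.of Λ (∀ i, F i)) :=
    inferInstanceAs (Module.Finite Λ (∀ i, F i))
  refine ⟨⨁ F, finite_of_iso (ModuleCat.biproductIsoPi F).symm hfin, fun X hX => ?_⟩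
  refine fg_induction (Λ := Λ) (fun X => InAdd Λ (⨁ F) X) (fun X Y e h => h.of_iso e.symm)
    (fun X h => inAdd_of_isZero h) (fun X Y => InAdd.biprod) (fun X hX hXi => ?_) X hX
  obtain ⟨a, b, hX⟩ := hP.exists_isInt_of_indec hU hI hX hXi
  have hba := hX.sub_le hP
  have hXl := hX.2
  have h1 := Int.emod_nonneg a (b := n) (by lia)
  have h2 := Int.emod_lt_of_pos a (b := n) (by lia)
  let i : Fin n × Fin (m + 1) := ⟨⟨(a % n).toNat, by lia⟩, ⟨(b - a).toNat, by lia⟩⟩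
  have hi₁ : ((i.1 : ℕ) : ℤ) = a % n := Int.toNat_of_nonneg h1
  have hi₂ : ((i.2 : ℕ) : ℤ) = b - a := Int.toNat_of_nonneg (by lia)
  have hX' : IsInt P X i.1 (i.1 + i.2) :=
    hX.shift hP (by rw [hi₁]; exact (Int.mod_modEq a n).symm) (by lia)
  obtain ⟨j⟩ := hX'.nonempty_iso hP (hF i)
  exact ((inAdd_self (⨁ F)).of_retract
    ⟨biproduct.ι F i, biproduct.π F i, biproduct.ι_π_self F i⟩).of_iso j

lemma CyclicFamily.domdimGE_two (hP : CyclicFamily n m P)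
    (hU : ∀ X : ModuleCat.{u} Λ, Module.Finite Λ X → Indec Λ X → Uniserial Λ X)
    (hI : Injective (ModuleCat.of Λ Λ)) {A : Type u} [Ring A] {M : ModuleCat.{u} Λ}
    (e : A ≃+* (End M)ᵐᵒᵖ) (hMf : Module.Finite Λ M)
    (hM : ∀ X : ModuleCat.{u} Λ, Module.Finite Λ X → InAdd Λ M X) : DomdimGE A 2 := by
  obtain ⟨E₀, φ, hE₀, hE₀i, hφ⟩ := hP.exists_mono_injective hU hI M hMf
  have hC : Module.Finite Λ (cokernel φ : ModuleCat Λ) :=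
    Module.Finite.of_surjective (cokernel.π φ).hom
      ((ModuleCat.epi_iff_surjective (cokernel.π φ)).1 inferInstance)
  obtain ⟨E₁, ψ, hE₁, hE₁i, hψ⟩ := hP.exists_mono_injective hU hI _ hC
  have hΛ : Module.Finite Λ (ModuleCat.of Λ Λ) := inferInstanceAs (Module.Finite Λ Λ)
  have w : φ ≫ cokernel.π φ ≫ ψ = 0 := by rw [cokernel.condition_assoc, zero_comp]
  refine Rigidity.domdimGE_two e (hM _ hΛ) (hM _ hE₀) (hM _ hE₁) φ (cokernel.π φ ≫ ψ) w ?_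
  have h1 : (ShortComplex.mk φ (cokernel.π φ) (cokernel.condition φ)).Exact :=
    ShortComplex.exact_cokernel φ
  let α : ShortComplex.mk φ (cokernel.π φ) (cokernel.condition φ) ⟶
      ShortComplex.mk φ (cokernel.π φ ≫ ψ) w := { τ₁ := 𝟙 _, τ₂ := 𝟙 _, τ₃ := ψ }
  have : Mono α.τ₃ := hψ
  have : Epi α.τ₁ := inferInstanceAs (Epi (𝟙 M))
  have : IsIso α.τ₂ := inferInstanceAs (IsIso (𝟙 E₀))
  exact (ShortComplex.exact_iff_of_epi_of_isIso_of_mono α).1 h1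

end Auslander

/-- Corollary `K03eq`: for `Λ = A_{n,m}` with `m = k₀n + s₁`, `k₀ ≥ 3`,
`0 < s₁ < n`, the rigidity dimension is `2`; i.e. every generator-cogenerator `M` whose
endomorphism algebra has finite global dimension satisfies `Ext¹_Λ(M,M) ≠ 0`. -/
theorem statement13 (k : Type u) [Field k] (Λ : Type u) [Ring Λ] [Algebra k Λ]
    (n m : ℕ) (hn : 0 < n) (hnm : n ≤ m)
    (hΛ : IsSelfInjNakayama k Λ n m)
    [HasExt.{u} (ModuleCat.{u} Λ)]
    (k0 s1 : ℕ) (hm : m = k0 * n + s1) (hk0 : 3 ≤ k0) (hs1 : 0 < s1) (hs1n : s1 < n) :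
    rigdim Λ = 2 ∧
    ∀ M : ModuleCat.{u} Λ, Module.Finite Λ M → IsGenCogen Λ M →
      (∃ r : ℕ, GldimLE (End (op M)) r) → ¬ Subsingleton (Abelian.Ext M M 1) := by
  have hfd := hΛ.findim
  have hart : IsArtinianRing Λ := isArtinian_of_tower k inferInstance
  have hU : ∀ X : ModuleCat.{u} Λ, Module.Finite Λ X → Indec Λ X → Uniserial Λ X := hΛ.uniserial
  have hI := hΛ.selfinj
  have hmn : 3 * n ≤ m := by nlinarith
  obtain ⟨L, P, hP⟩ := exists_cyclicFamily hU hI hΛ.connected (by lia) hΛ.simples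
  obtain rfl := hP.loewy_eq hU hI (by lia) hΛ.loewy_top hΛ.loewy_bot
  have key (M : ModuleCat.{u} Λ) (hMf : Module.Finite Λ M) (hM : IsGenCogen Λ M)
      (hr : ∃ r : ℕ, GldimLE (End (op M)) r) : ¬ Subsingleton (Abelian.Ext M M 1) := by
    obtain ⟨r, hr⟩ := hr
    exact fun hE => hP.not_gldimLE hU hI hMf hM hn hmn hE r hr
  refine ⟨le_antisymm (sSup_le ?_) ?_, key⟩
  · rintro _ ⟨M, hMf, hM, hr, rfl⟩
    refine sSup_le ?_
    rintro _ ⟨r, rfl, h⟩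
    by_contra! h2
    have h3 : 3 ≤ r := by exact_mod_cast h2
    exact key M hMf hM hr (ext_one_subsingleton_of_domdimGE (endOpRingEquiv M) hM.1 r h3 h)
  · obtain ⟨M, hMf, hM⟩ := hP.exists_forall_inAdd hn hU hI
    have hreg : Module.Finite Λ (ModuleCat.of Λ Λ) := inferInstanceAs (Module.Finite Λ Λ)
    have hgl : ∃ r : ℕ, GldimLE (End (op M)) r :=
      ⟨2, gldimLE_two_of_forall_inAdd (endOpRingEquiv M) k hM⟩
    have h1 : domdim (End (op M)) ≤ rigdim Λ :=
      le_sSup ⟨M, hMf, ⟨hM _ hreg, fun I hI _ => hM I hI⟩, hgl, rfl⟩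
    have h2 : (2 : ℕ∞) ≤ domdim (End (op M)) :=
      le_sSup ⟨2, by norm_num, hP.domdimGE_two hU hI (endOpRingEquiv M) hMf hM⟩
    exact h2.trans h1

end Rigidity
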